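/- arXiv:1702.05113 — 2 statements merged into one kernel-verified Lean document; each statement's English description precedes it below -/
import Mathlib

section
/- Let g : ℝ^n → ℝ be convex and θ ∈ ℝ^n, and suppose the minimum-norm element v_0 of aff(∂g(θ)) is nonzero. Then: (a) for every z ∈ ℝ^n, the minimizer λ(z) of λ ↦ dist(z, λ∂g(θ)) over λ ≥ 0 exists uniquely, and E λ(Z) < ∞ for Z ∼ N_n(0, I_n); (b) setting λ* := E λ(Z) + 2/‖v_0‖, for every λ ≥ λ* and every v* ∈ ∂g(θ), D(λ∂g(θ)) ≤ 4 + ( sqrt(D(cone(∂g(θ)))) + 4‖v*‖/‖v_0‖ + 2 + (λ − λ*)‖v*‖ )². -/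
open MeasureTheory ProbabilityTheory
open scoped BigOperators

noncomputable section

/-- Zero-padding of a finite vector to a sequence on `ℕ`. -/
def pad {n : ℕ} (θ : Fin n → ℝ) : ℕ → ℝ := fun t => if h : t < n then θ ⟨t, h⟩ else 0

/-- First-order forward difference of a sequence. -/
def dseq (f : ℕ → ℝ) : ℕ → ℝ := fun t => f (t + 1) - f t

/-- `DD r θ t` is the `t`-th entry (0-indexed) of the `r`-th order difference `D^{(r)} θ`
of the vector `θ ∈ ℝ^n`; only the entries `t < n - r` are meaningful. -/
def DD (r : ℕ) {n : ℕ} (θ : Fin n → ℝ) : ℕ → ℝ := dseq^[r] (pad θ)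

/-- The ℓ¹ norm `‖D^{(r)} θ‖₁`. -/
def Dl1 (r : ℕ) {n : ℕ} (θ : Fin n → ℝ) : ℝ := ∑ t ∈ Finset.range (n - r), |DD r θ t|

/-- The number of nonzero entries `‖D^{(r)} θ‖₀`. -/
def Dl0 (r : ℕ) {n : ℕ} (θ : Fin n → ℝ) : ℕ :=
  ((Finset.range (n - r)).filter fun t => DD r θ t ≠ 0).card

/-- Squared Euclidean norm. -/
def sqnorm {n : ℕ} (x : Fin n → ℝ) : ℝ := ∑ i, x i ^ 2

/-- Euclidean norm. -/
def eunorm {n : ℕ} (x : Fin n → ℝ) : ℝ := Real.sqrt (sqnorm x)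

/-- `V^{(r)}(θ) = n^{r-1} ‖D^{(r)} θ‖₁`. -/
def Vr (r : ℕ) {n : ℕ} (θ : Fin n → ℝ) : ℝ := (n : ℝ) ^ ((r : ℤ) - 1) * Dl1 r θ

/-- The constraint set `K^{(r)}(V) = {θ : ‖D^{(r)} θ‖₁ ≤ V n^{1-r}}`. -/
def Kset (r n : ℕ) (V : ℝ) : Set (Fin n → ℝ) := {θ | Dl1 r θ ≤ V * (n : ℝ) ^ (1 - (r : ℤ))}

/-- `est` is a least-squares projection onto the set `K`. -/
def IsProjOn {n : ℕ} (est : (Fin n → ℝ) → Fin n → ℝ) (K : Set (Fin n → ℝ)) : Prop :=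
  ∀ y, est y ∈ K ∧ ∀ θ ∈ K, sqnorm (y - est y) ≤ sqnorm (y - θ)

/-- `est` is the penalized trend filtering estimator of order `r` with noise level `σ`
and tuning parameter `lam`: it minimizes `½‖y - θ‖² + σ n^{r-1} lam ‖D^{(r)} θ‖₁`. -/
def IsPenEst (r : ℕ) {n : ℕ} (σ lam : ℝ) (est : (Fin n → ℝ) → Fin n → ℝ) : Prop :=
  ∀ y θ, 1 / 2 * sqnorm (y - est y) + σ * (n : ℝ) ^ ((r : ℤ) - 1) * lam * Dl1 r (est y) ≤
    1 / 2 * sqnorm (y - θ) + σ * (n : ℝ) ^ ((r : ℤ) - 1) * lam * Dl1 r θ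

/-- The Gaussian measure `N_n(0, σ² I_n)` on `ℝ^n`. -/
def gaussVec (n : ℕ) (σ : ℝ) : Measure (Fin n → ℝ) :=
  Measure.pi fun _ => gaussianReal 0 (σ ^ 2).toNNReal

/-- The risk `R(θ̂, θ*) = (1/n) E ‖θ̂(θ* + ξ) - θ*‖²` for `ξ ∼ N_n(0, σ² I_n)`. -/
def risk {n : ℕ} (σ : ℝ) (est : (Fin n → ℝ) → Fin n → ℝ) (θs : Fin n → ℝ) : ℝ :=
  1 / (n : ℝ) * ∫ ξ, sqnorm (est (θs + ξ) - θs) ∂gaussVec n σ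

/-- `j` (with signs `sg`) enumerates, in increasing order and paper (1-indexed) convention,
exactly the `r`-th order knots of `θ ∈ ℝ^n`; an index `2 ≤ m ≤ n - r + 1` is a knot when
`(D^{(r-1)}θ)_{m-1} ≠ (D^{(r-1)}θ)_m` (1-indexed entries), and its sign is `+1` when
`(D^{(r-1)}θ)_{m-1} < (D^{(r-1)}θ)_m` and `-1` otherwise. -/
def IsKnotSeq (r n : ℕ) (θ : Fin n → ℝ) (k : ℕ) (j : Fin k → ℕ) (sg : Fin k → ℝ) : Prop :=
  StrictMono j ∧ (∀ i, 2 ≤ j i ∧ j i ≤ n - r + 1) ∧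
    (∀ m : ℕ, 2 ≤ m → m ≤ n - r + 1 →
      (DD (r - 1) θ (m - 2) ≠ DD (r - 1) θ (m - 1) ↔ ∃ i, j i = m)) ∧
    ∀ i, sg i = if DD (r - 1) θ (j i - 2) < DD (r - 1) θ (j i - 1) then 1 else -1

/-- Extended knot sequence: `jext 0 = j_0 = 1`, `jext i = j_i` for `1 ≤ i ≤ k`, and
`jext (k+1) = j_{k+1} = n - r + 2`. -/
def jext (n r k : ℕ) (j : Fin k → ℕ) : ℕ → ℕ := fun i =>
  if i = 0 then 1 else if h : i - 1 < k then j ⟨i - 1, h⟩ else n - r + 2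

/-- Extended sign sequence: `sgext i = 𝔯_i` for `1 ≤ i ≤ k` and `0` otherwise. -/
def sgext (k : ℕ) (sg : Fin k → ℝ) : ℕ → ℝ := fun i =>
  if h : 0 < i ∧ i - 1 < k then sg ⟨i - 1, h.2⟩ else 0

/-- The lengths `n_0 = j_1 + r - 2`, `n_i = j_{i+1} - j_i` (`1 ≤ i ≤ k-1`),
`n_k = n - r + 2 - j_k`. -/
def nlen (n r k : ℕ) (j : Fin k → ℕ) : ℕ → ℕ := fun i =>
  if i = 0 then jext n r k j 1 + r - 2 else jext n r k j (i + 1) - jext n r k j i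

/-- `n_{i*} = min(n_i, n/(k+1))`. -/
def nstar (n r k : ℕ) (j : Fin k → ℕ) (i : ℕ) : ℝ :=
  min (nlen n r k j i : ℝ) ((n : ℝ) / ((k : ℝ) + 1))

/-- `δ_r(θ)²` defined from the knot data of `θ`. -/
def deltaSq (n r k : ℕ) (j : Fin k → ℕ) (sg : Fin k → ℝ) : ℝ :=
  nstar n r k j 0 ^ (1 - 2 * (r : ℤ)) + nstar n r k j k ^ (1 - 2 * (r : ℤ)) +
    ∑ i ∈ Finset.Ico 1 k,
      if sgext k sg i ≠ sgext k sg (i + 1) then nstar n r k j i ^ (1 - 2 * (r : ℤ)) else 0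

/-- `Δ_r(θ)` defined from the knot data of `θ`. -/
def DeltaR (n r k : ℕ) (j : Fin k → ℕ) (sg : Fin k → ℝ) : ℝ :=
  ((k : ℝ) + 1) / (n : ℝ) * Real.log (Real.exp 1 * (n : ℝ) / ((k : ℝ) + 1)) +
    deltaSq n r k j sg / (n : ℝ) * ((n : ℝ) / ((k : ℝ) + 1)) ^ (2 * (r : ℤ) - 1) *
      Real.log (Real.exp 1 * (n : ℝ) / ((k : ℝ) + 1)) +
    (Real.sqrt (deltaSq n r k j sg) / Real.sqrt (n : ℝ)) ^ ((1 : ℝ) / (r : ℝ))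

/-- The minimum length condition with constant `c`: `n_i ≥ c n/(k+1)` for every `0 ≤ i ≤ k`
with `𝔯_i ≠ 𝔯_{i+1}` (where `𝔯_0 = 𝔯_{k+1} = 0`). -/
def MinLen (n r k : ℕ) (j : Fin k → ℕ) (sg : Fin k → ℝ) (c : ℝ) : Prop :=
  ∀ i ≤ k, sgext k sg i ≠ sgext k sg (i + 1) →
    c * (n : ℝ) / ((k : ℝ) + 1) ≤ (nlen n r k j i : ℝ)

/-- The subdifferential of `g` at `θ`. -/
def subdiff {n : ℕ} (g : (Fin n → ℝ) → ℝ) (θ : Fin n → ℝ) : Set (Fin n → ℝ) :=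
  {v | ∀ y, g θ + ∑ i, v i * (y i - θ i) ≤ g y}

/-- `v` is the minimum-norm element of `S`. -/
def IsMinNormIn {n : ℕ} (v : Fin n → ℝ) (S : Set (Fin n → ℝ)) : Prop :=
  v ∈ S ∧ ∀ w ∈ S, eunorm v ≤ eunorm w

/-- `c • S`. -/
def scaleSet {n : ℕ} (c : ℝ) (S : Set (Fin n → ℝ)) : Set (Fin n → ℝ) := (c • ·) '' S

/-- The cone generated by `S`: `⋃_{c ≥ 0} c • S`. -/
def coneOf {n : ℕ} (S : Set (Fin n → ℝ)) : Set (Fin n → ℝ) := ⋃ c ∈ Set.Ici (0 : ℝ), scaleSet c S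

/-- Euclidean distance from a point to a set. -/
def distSet {n : ℕ} (z : Fin n → ℝ) (S : Set (Fin n → ℝ)) : ℝ :=
  sInf ((fun v => eunorm (z - v)) '' S)

/-- Gaussian mean squared distance `D(S) = E dist²(Z, S)`, `Z ∼ N_n(0, I_n)`. -/
def gaussMSD {n : ℕ} (S : Set (Fin n → ℝ)) : ℝ := ∫ z, distSet z S ^ 2 ∂gaussVec n 1

/-- `lam z` is, for each `z`, the minimizer over `λ ≥ 0` of `dist(z, λ S)`. -/
def IsLamFun {n : ℕ} (S : Set (Fin n → ℝ)) (lam : (Fin n → ℝ) → ℝ) : Prop :=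
  ∀ z, 0 ≤ lam z ∧ ∀ μ : ℝ, 0 ≤ μ → distSet z (scaleSet (lam z) S) ≤ distSet z (scaleSet μ S)

/-- Euclidean covering number of `K` at scale `ε`. -/
def covN {n : ℕ} (ε : ℝ) (K : Set (Fin n → ℝ)) : ℕ :=
  sInf {m : ℕ | ∃ a : Fin m → Fin n → ℝ, ∀ x ∈ K, ∃ i, eunorm (x - a i) ≤ ε}

/-- `K` `t`-shatters the (finite) index set `A`. -/
def fatShatters {n : ℕ} (K : Set (Fin n → ℝ)) (t : ℝ) (A : Finset (Fin n)) : Prop :=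
  ∃ h : Fin n → ℝ, ∀ S : Finset (Fin n), S ⊆ A →
    ∃ θ ∈ K, (∀ i ∈ S, θ i ≤ h i) ∧ ∀ i ∈ A, i ∉ S → h i + t ≤ θ i

/-- The fat shattering dimension `v(K, t)`. -/
def fatDim {n : ℕ} (K : Set (Fin n → ℝ)) (t : ℝ) : ℕ :=
  sSup {m : ℕ | ∃ A : Finset (Fin n), A.card = m ∧ fatShatters K t A}

/-- The tangent cone of `K` at `θ`. -/
def tanCone {n : ℕ} (K : Set (Fin n → ℝ)) (θ : Fin n → ℝ) : Set (Fin n → ℝ) :=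
  closure {w | ∃ t : ℝ, 0 ≤ t ∧ ∃ η ∈ K, w = t • (η - θ)}

/-- `V_{a,b}(f) = Σ_{m=a+1}^{b} |f_m - f_{m-1}|` for the (paper 1-indexed) sequence whose
`m`-th entry is `f (m-1)`. -/
def Vab (f : ℕ → ℝ) (a b : ℕ) : ℝ := ∑ t ∈ Finset.Ico (a - 1) (b - 1), |f (t + 1) - f t|

/-- `Acoef r n v j = Σ_{i=j}^n C(r+i-j-1, r-1) v_i` (paper 1-indexed). -/
def Acoef (r n : ℕ) (v : Fin n → ℝ) (jj : ℕ) : ℝ :=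
  ∑ i : Fin n, (if jj ≤ i.1 + 1 then ((r + (i.1 + 1) - jj - 1).choose (r - 1) : ℝ) else 0) * v i

/-- The class `C_r({a_i}, {s_i})`. -/
def Cras (r n : ℕ) (a s : ℕ → ℝ) : Set (Fin n → ℝ) :=
  {θ | (∀ i < r - 1, a i ≤ DD i θ 0 ∧ DD i θ 0 ≤ a i + s i) ∧
    a (r - 1) ≤ DD (r - 1) θ 0 ∧
    (∀ t : ℕ, t + 1 ≤ n - r → DD (r - 1) θ t ≤ DD (r - 1) θ (t + 1)) ∧
    DD (r - 1) θ (n - r) ≤ a (r - 1) + s (r - 1)}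

/-- The class `C_r(a, V) = {θ : a ≤ (D^{(r-1)}θ)_1 ≤ ⋯ ≤ (D^{(r-1)}θ)_{n-r+1} ≤ a + V}`. -/
def CrMono (r n : ℕ) (a V : ℝ) : Set (Fin n → ℝ) :=
  {θ | a ≤ DD (r - 1) θ 0 ∧
    (∀ t : ℕ, t + 1 ≤ n - r → DD (r - 1) θ t ≤ DD (r - 1) θ (t + 1)) ∧
    DD (r - 1) θ (n - r) ≤ a + V}


open scoped NNReal

theorem pi_gauss_ac (n : ℕ) :
    (Measure.pi fun _ : Fin n => gaussianReal 0 1) ≪ (volume : Measure (Fin n → ℝ)) := by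
  induction n with
  | zero =>
    rw [volume_pi, Measure.pi_of_empty _ (fun i => i.elim0), Measure.pi_of_empty _ (fun i => i.elim0)]
  | succ n ih =>
    have h1 := (measurePreserving_piFinSuccAbove (fun _ : Fin (n+1) => gaussianReal 0 1) 0).symm
    have h2 := (measurePreserving_piFinSuccAbove (fun _ : Fin (n+1) => (volume : Measure ℝ)) 0).symm
    rw [volume_pi, ← h1.map_eq, ← h2.map_eq]
    refine Measure.AbsolutelyContinuous.map ?_ (MeasurableEquiv.measurable _)
    refine Measure.AbsolutelyContinuous.prod ?_ ih
    exact gaussianReal_absolutelyContinuous 0 (by norm_num)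

theorem std_ac (n : ℕ) :
    stdGaussian (EuclideanSpace ℝ (Fin n)) ≪ (volume : Measure (EuclideanSpace ℝ (Fin n))) := by
  rw [← map_pi_eq_stdGaussian, ← (PiLp.volume_preserving_toLp (Fin n)).map_eq]
  exact (pi_gauss_ac n).map (by fun_prop)

theorem lip_memLp {E : Type*} [NormedAddCommGroup E] [InnerProductSpace ℝ E] [FiniteDimensional ℝ E]
    [MeasurableSpace E] [BorelSpace E] (γ : Measure E) [IsGaussian γ]
    {f : E → ℝ} {K : ℝ≥0} (hf : LipschitzWith K f) : MemLp f 2 γ := by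
  have h0 : MemLp (fun x : E => ‖x‖) 2 γ := (IsGaussian.memLp_two_id (μ := γ)).norm
  have h : MemLp (fun x : E => |f 0| + K * ‖x‖) 2 γ := (memLp_const |f 0|).add (h0.const_mul (K:ℝ))
  refine h.mono' hf.continuous.aestronglyMeasurable (.of_forall fun x => ?_)
  have := hf.dist_le_mul x 0
  rw [Real.dist_eq, dist_zero_right] at this
  have := abs_sub_abs_le_abs_sub (f x) (f 0)
  rw [Real.norm_eq_abs]; linarith

open ContinuousLinearMap in
theorem rot_rot {E : Type*} [NormedAddCommGroup E] [NormedSpace ℝ E] (s t : ℝ) (p : E × E) :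
    rotation s (rotation t p) = rotation (s+t) p := by
  refine Prod.ext ?_ ?_
  · change Real.cos s • (Real.cos t • p.1 + Real.sin t • p.2) + Real.sin s • (-Real.sin t • p.1 + Real.cos t • p.2) =
      Real.cos (s + t) • p.1 + Real.sin (s + t) • p.2
    rw [Real.cos_add, Real.sin_add]
    module
  · change -Real.sin s • (Real.cos t • p.1 + Real.sin t • p.2) + Real.cos s • (-Real.sin t • p.1 + Real.cos t • p.2) =
      -Real.sin (s + t) • p.1 + Real.cos (s + t) • p.2
    rw [Real.cos_add, Real.sin_add]
    module

/-- Increment functional. -/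
noncomputable def incF {E : Type*} [NormedAddCommGroup E] [NormedSpace ℝ E] (f : E → ℝ) (h : ℝ) (p : E × E) : ℝ :=
  f (Real.cos h • p.1 + Real.sin h • p.2) - f p.1

theorem incF_bound {E : Type*} [NormedAddCommGroup E] [NormedSpace ℝ E] {f : E → ℝ} {K : ℝ≥0}
    (hf : LipschitzWith K f) (h : ℝ) (p : E × E) : |incF f h p| ≤ K * (|h| * (‖p.1‖ + ‖p.2‖)) := by
  have h1 := hf.dist_le_mul (Real.cos h • p.1 + Real.sin h • p.2) p.1
  rw [Real.dist_eq, dist_eq_norm] at h1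
  refine h1.trans (mul_le_mul_of_nonneg_left ?_ K.2)
  have e : Real.cos h • p.1 + Real.sin h • p.2 - p.1 = (Real.cos h - 1) • p.1 + Real.sin h • p.2 := by module
  rw [e]
  refine (norm_add_le _ _).trans ?_
  rw [norm_smul, norm_smul, mul_add]
  have hc : |Real.cos h - 1| ≤ |h| := by
    have := Real.abs_cos_sub_cos_le h 0
    simpa using this
  have hs : |Real.sin h| ≤ |h| := Real.abs_sin_le_abs
  simp only [Real.norm_eq_abs]
  gcongr


section P
set_option linter.unusedSectionVars false
variable {E : Type*} [NormedAddCommGroup E] [InnerProductSpace ℝ E] [FiniteDimensional ℝ E]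
    [MeasurableSpace E] [BorelSpace E] (γ : Measure E) [IsGaussian γ]

theorem bound_int (C : ℝ) :
    Integrable (fun p : E × E => (C * (‖p.1‖ + ‖p.2‖)) ^ 2) (γ.prod γ) := by
  have h0 : MemLp (fun x : E => ‖x‖) 2 γ := (IsGaussian.memLp_two_id (μ := γ)).norm
  have h1 : MemLp (fun p : E × E => ‖p.1‖) 2 (γ.prod γ) :=
    h0.comp_measurePreserving measurePreserving_fst
  have h2 : MemLp (fun p : E × E => ‖p.2‖) 2 (γ.prod γ) :=
    h0.comp_measurePreserving measurePreserving_snd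
  exact ((h1.add h2).const_mul C).integrable_sq

theorem incF_cont {f : E → ℝ} {K : ℝ≥0} (hf : LipschitzWith K f) (h : ℝ) : Continuous (incF f h) := by
  have := hf.continuous
  unfold incF
  fun_prop

theorem incF_int {f : E → ℝ} {K : ℝ≥0} (hf : LipschitzWith K f) (h : ℝ) :
    Integrable (fun p => incF f h p ^ 2) (γ.prod γ) := by
  refine (bound_int γ (K * |h|)).mono' ((incF_cont hf h).pow 2).aestronglyMeasurable
    (.of_forall fun p => ?_)
  rw [Real.norm_eq_abs, abs_pow, mul_assoc]
  exact pow_le_pow_left₀ (abs_nonneg _) (incF_bound hf h p) 2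

open ContinuousLinearMap in
theorem poincare_step (h0 : γ[id] = 0) {f : E → ℝ} {K : ℝ≥0} (hf : LipschitzWith K f)
    (N : ℕ) (hN : 0 < N) :
    ∫ p, (f p.2 - f p.1) ^ 2 ∂(γ.prod γ) ≤
    ∫ p, (N * incF f (Real.pi / 2 / N) p) ^ 2 ∂(γ.prod γ) := by
  set h := Real.pi / 2 / N with hh
  have hNh : (N:ℝ) * h = Real.pi / 2 := by rw [hh]; field_simp
  have key : ∀ t : ℝ, MeasurePreserving (rotation t : E × E →L[ℝ] E × E) (γ.prod γ) (γ.prod γ) :=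
    fun t => ⟨(rotation t).continuous.measurable, IsGaussian.map_rotation_eq_self h0 t⟩
  have hIntg := incF_int γ hf h
  have hk : ∀ t : ℝ, ∫ p, incF f h (rotation t p) ^ 2 ∂(γ.prod γ) = ∫ p, incF f h p ^ 2 ∂(γ.prod γ) := by
    intro t
    conv_rhs => rw [← (key t).map_eq]
    rw [integral_map (key t).aemeasurable]
    exact ((incF_cont hf h).pow 2).aestronglyMeasurable
  have hki : ∀ t : ℝ, Integrable (fun p => incF f h (rotation t p) ^ 2) (γ.prod γ) := fun t =>
    (key t).integrable_comp_of_integrable hIntg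
  have tele : ∀ p : E × E, f p.2 - f p.1 = ∑ k ∈ Finset.range N, incF f h (rotation (k * h) p) := by
    intro p
    have e : ∀ k : ℕ, incF f h (rotation (k * h) p) =
        (fun k : ℕ => f (rotation (k * h) p).1) (k+1) - (fun k : ℕ => f (rotation (k * h) p).1) k := by
      intro k
      have := rot_rot h (k * h) p
      have e2 : h + k * h = ((k + 1 : ℕ) : ℝ) * h := by push_cast; ring
      rw [e2] at this
      simp only []
      rw [← this]
      rfl
    rw [Finset.sum_congr rfl fun k _ => e k, Finset.sum_range_sub (fun k : ℕ => f (rotation (k * h) p).1)]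
    have e1 : ∀ t : ℝ, (rotation t p).1 = Real.cos t • p.1 + Real.sin t • p.2 := fun _ => rfl
    simp only [e1, hNh]
    simp
  calc ∫ p, (f p.2 - f p.1) ^ 2 ∂(γ.prod γ)
      ≤ ∫ p, (N : ℝ) * ∑ k ∈ Finset.range N, incF f h (rotation (k * h) p) ^ 2 ∂(γ.prod γ) := by
        refine integral_mono_of_nonneg (.of_forall fun p => sq_nonneg _) ?_ (.of_forall fun p => ?_)
        · exact (integrable_finsetSum _ fun k _ => hki _).const_mul _
        · simp only []
          rw [tele p]
          simpa using sq_sum_le_card_mul_sum_sq (s := Finset.range N) (f := fun k => incF f h (rotation (k * h) p))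
    _ = N * (N * ∫ p, incF f h p ^ 2 ∂(γ.prod γ)) := by
        rw [integral_const_mul, integral_finsetSum _ fun k _ => hki _]
        simp [hk]
    _ = _ := by
        simp_rw [mul_pow]
        rw [integral_const_mul]; ring

theorem incF_lim {f : E → ℝ} {p : E × E} (hd : DifferentiableAt ℝ f p.1) :
    Filter.Tendsto (fun N : ℕ => (N * incF f (Real.pi / 2 / N) p) ^ 2) Filter.atTop
      (nhds ((Real.pi / 2 * fderiv ℝ f p.1 p.2) ^ 2)) := by
  refine Filter.Tendsto.pow ?_ 2
  have hder : HasDerivAt (fun h : ℝ => f (Real.cos h • p.1 + Real.sin h • p.2)) (fderiv ℝ f p.1 p.2) 0 := by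
    have h1 : HasDerivAt (fun h : ℝ => Real.cos h • p.1 + Real.sin h • p.2)
        ((-Real.sin 0) • p.1 + Real.cos 0 • p.2) 0 :=
      ((Real.hasDerivAt_cos 0).smul_const p.1).add ((Real.hasDerivAt_sin 0).smul_const p.2)
    have e : Real.cos 0 • p.1 + Real.sin 0 • p.2 = p.1 := by simp
    have h2 : HasFDerivAt f (fderiv ℝ f p.1) (Real.cos 0 • p.1 + Real.sin 0 • p.2) := by
      rw [e]; exact hd.hasFDerivAt
    have := h2.comp_hasDerivAt (0:ℝ) h1
    rw [Real.sin_zero, Real.cos_zero, neg_zero, zero_smul, zero_add, one_smul] at this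
    exact this
  have hs := hder.tendsto_slope_zero
  have hlim : Filter.Tendsto (fun N : ℕ => Real.pi / 2 / (N:ℝ)) Filter.atTop (nhdsWithin 0 {0}ᶜ) := by
    refine tendsto_nhdsWithin_iff.2 ⟨tendsto_const_div_atTop_nhds_zero_nat _, ?_⟩
    filter_upwards [Filter.eventually_gt_atTop 0] with N hN
    have : (0:ℝ) < N := by exact_mod_cast hN
    have := Real.pi_pos
    simp only [Set.mem_compl_iff, Set.mem_singleton_iff]
    positivity
  have := (hs.comp hlim).const_mul (Real.pi / 2)
  refine this.congr' ?_
  filter_upwards [Filter.eventually_gt_atTop 0] with N hN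
  have : (0:ℝ) < N := by exact_mod_cast hN
  have := Real.pi_pos
  simp [incF]
  field_simp

end P

section Q
variable {E : Type*} [NormedAddCommGroup E] [InnerProductSpace ℝ E] [FiniteDimensional ℝ E]
    [MeasurableSpace E] [BorelSpace E]

theorem poincare_pair (μ : Measure E) [μ.IsAddHaarMeasure] (hac : stdGaussian E ≪ μ)
    {f : E → ℝ} {K : ℝ≥0} (hf : LipschitzWith K f) :
    ∫ p, (f p.2 - f p.1) ^ 2 ∂((stdGaussian E).prod (stdGaussian E)) ≤ (Real.pi / 2) ^ 2 * K ^ 2 := by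
  set γ := stdGaussian E with hγ
  have hγ0 : γ[id] = 0 := by simp [hγ]
  have hdiff : ∀ᵐ p ∂(γ.prod γ), DifferentiableAt ℝ f p.1 := by
    have : ∀ᵐ x ∂γ, DifferentiableAt ℝ f x := hac.ae_le hf.ae_differentiableAt
    exact (measurePreserving_fst (μ := γ) (ν := γ)).quasiMeasurePreserving.ae this
  have hlim : Filter.Tendsto (fun N : ℕ => ∫ p, (N * incF f (Real.pi / 2 / N) p) ^ 2 ∂(γ.prod γ))
      Filter.atTop (nhds (∫ p, (Real.pi / 2 * fderiv ℝ f p.1 p.2) ^ 2 ∂(γ.prod γ))) := by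
    refine tendsto_integral_of_dominated_convergence
      (fun p => (K * (Real.pi / 2) * (‖p.1‖ + ‖p.2‖)) ^ 2) ?_ (bound_int γ _) ?_ ?_
    · intro N
      exact ((continuous_const.mul (incF_cont hf _)).pow 2).aestronglyMeasurable
    · intro N
      refine .of_forall fun p => ?_
      rw [Real.norm_eq_abs, abs_pow]
      refine pow_le_pow_left₀ (abs_nonneg _) ?_ 2
      rw [abs_mul, Nat.abs_cast]
      have h1 := incF_bound hf (Real.pi / 2 / N) p
      have hp := Real.pi_pos
      rcases Nat.eq_zero_or_pos N with h0 | h0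
      · subst h0; simp; positivity
      · have hN : (0:ℝ) < N := by exact_mod_cast h0
        calc (N:ℝ) * |incF f (Real.pi / 2 / N) p| ≤ N * (K * (|Real.pi / 2 / N| * (‖p.1‖ + ‖p.2‖))) := by gcongr
          _ = _ := by rw [abs_of_pos (by positivity)]; field_simp
    · filter_upwards [hdiff] with p hp using incF_lim hp
  have h1 := ge_of_tendsto hlim ((Filter.eventually_gt_atTop 0).mono fun N hN => poincare_step γ hγ0 hf N hN)
  refine h1.trans ?_
  have hop : ∀ x, ‖fderiv ℝ f x‖ ≤ K := fun x => norm_fderiv_le_of_lipschitz ℝ hf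
  have hmeas : Measurable (fun p : E × E => (Real.pi / 2 * fderiv ℝ f p.1 p.2) ^ 2) := by
    have := (measurable_fderiv ℝ f).comp (measurable_fst : Measurable (Prod.fst : E × E → E))
    refine (Measurable.const_mul ?_ _).pow_const 2
    have h2 : Continuous (fun q : (E →L[ℝ] ℝ) × E => q.1 q.2) := by fun_prop
    exact h2.measurable.comp (this.prodMk measurable_snd)
  have hIntg : Integrable (fun p : E × E => (Real.pi / 2 * fderiv ℝ f p.1 p.2) ^ 2) (γ.prod γ) := by
    refine (bound_int γ (Real.pi / 2 * K)).mono' hmeas.aestronglyMeasurable (.of_forall fun p => ?_)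
    rw [Real.norm_eq_abs, abs_pow]
    refine pow_le_pow_left₀ (abs_nonneg _) ?_ 2
    have hp := Real.pi_pos
    rw [abs_mul, abs_of_pos (by positivity : 0 < Real.pi / 2), mul_assoc]
    have h2 := (fderiv ℝ f p.1).le_opNorm p.2
    rw [Real.norm_eq_abs] at h2
    have h3 := hop p.1
    have : |(fderiv ℝ f p.1) p.2| ≤ K * (‖p.1‖ + ‖p.2‖) :=
      h2.trans (mul_le_mul h3 (by linarith [norm_nonneg p.1]) (norm_nonneg _) K.2)
    gcongr
  rw [integral_prod _ hIntg]
  have hin : ∀ x, ∫ y, (Real.pi / 2 * fderiv ℝ f x y) ^ 2 ∂γ = (Real.pi / 2) ^ 2 * ‖fderiv ℝ f x‖ ^ 2 := by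
    intro x
    have := variance_dual_stdGaussian (fderiv ℝ f x)
    rw [variance_of_integral_eq_zero (fderiv ℝ f x).continuous.aemeasurable
      (integral_strongDual_stdGaussian _)] at this
    simp_rw [mul_pow]
    rw [integral_const_mul, ← this]
  calc _ ≤ ∫ _x, (Real.pi / 2) ^ 2 * (K:ℝ) ^ 2 ∂γ := by
        refine integral_mono_of_nonneg (.of_forall fun x => ?_) (integrable_const _) (.of_forall fun x => ?_)
        · exact integral_nonneg fun y => sq_nonneg _
        · simp only []
          rw [hin]
          have := hop x
          gcongr
    _ = _ := by simp

theorem poincare_var (μ : Measure E) [μ.IsAddHaarMeasure] (hac : stdGaussian E ≪ μ)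
    {f : E → ℝ} {K : ℝ≥0} (hf : LipschitzWith K f) :
    Var[f; stdGaussian E] ≤ 4 / 3 * K ^ 2 := by
  have hp := poincare_pair μ hac hf
  set γ := stdGaussian E with hγ
  have hL := lip_memLp γ hf
  have hfi : Integrable f γ := hL.integrable (by norm_num)
  have hf2 : Integrable (fun x => f x ^ 2) γ := hL.integrable_sq
  have e : ∫ p, (f p.2 - f p.1) ^ 2 ∂(γ.prod γ) = 2 * Var[f; γ] := by
    have h1 : Integrable (fun p : E × E => f p.1 ^ 2) (γ.prod γ) := hf2.comp_fst γ
    have h2 : Integrable (fun p : E × E => f p.2 ^ 2) (γ.prod γ) := hf2.comp_snd γ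
    have h3 : Integrable (fun p : E × E => f p.1 * f p.2) (γ.prod γ) := hfi.mul_prod hfi
    have e1 : ∀ p : E × E, (f p.2 - f p.1) ^ 2 = f p.2 ^ 2 + f p.1 ^ 2 - 2 * (f p.1 * f p.2) := fun p => by ring
    simp_rw [e1]
    rw [integral_sub (f := fun p : E × E => f p.2 ^ 2 + f p.1 ^ 2) (h2.add h1) (h3.const_mul 2), integral_add h2 h1, integral_const_mul,
      integral_prod_mul, integral_fun_fst (fun x => f x ^ 2), integral_fun_snd (fun x => f x ^ 2), variance_eq_sub hL]
    simp
    ring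
  rw [e] at hp
  have hpi : Real.pi ^ 2 ≤ 10 := by nlinarith [Real.pi_lt_d2, Real.pi_pos]
  nlinarith [sq_nonneg (K:ℝ)]
end Q

section D
variable {E : Type*} [NormedAddCommGroup E] [InnerProductSpace ℝ E]

theorem cone_facts {S : Set E} (hc : IsCompact S) (hne : S.Nonempty) (hconv : Convex ℝ S)
    {v0 : E} (hv0 : v0 ≠ 0) (hS : ∀ v ∈ S, inner ℝ v v0 = ‖v0‖ ^ 2) (z : E) :
    ∃ l : ℝ, 0 ≤ l ∧ ∃ v ∈ S, ∀ c : ℝ, 0 ≤ c → ∀ w ∈ S, inner ℝ (z - l • v) (c • w - l • v) ≤ 0 := by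
  have hpos : 0 < ‖v0‖ := norm_pos_iff.2 hv0
  have hnorm : ∀ v ∈ S, ‖v0‖ ≤ ‖v‖ := by
    intro v hv
    have := real_inner_le_norm v v0
    rw [hS v hv] at this
    nlinarith
  obtain ⟨⟨l, v⟩, ⟨hl, hv⟩, hmin⟩ := ((isCompact_Icc (a := (0:ℝ)) (b := 2 * ‖z‖ / ‖v0‖)).prod hc).exists_isMinOn
    (f := fun p : ℝ × E => ‖z - p.1 • p.2‖)
    (⟨(0, hne.some), ⟨by constructor <;> positivity, hne.some_mem⟩⟩) (by fun_prop)
  have hmin' : ∀ c : ℝ, 0 ≤ c → ∀ w ∈ S, ‖z - l • v‖ ≤ ‖z - c • w‖ := by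
    intro c hc w hw
    by_cases h : c ≤ 2 * ‖z‖ / ‖v0‖
    · exact hmin (a := (c, w)) ⟨⟨hc, h⟩, hw⟩
    · have h0 : ‖z - l • v‖ ≤ ‖z‖ := by
        have := hmin (a := (0, hne.some)) ⟨⟨le_rfl, by positivity⟩, hne.some_mem⟩
        simpa using this
      push Not at h
      rw [div_lt_iff₀ hpos] at h
      have h1 : ‖c • w‖ - ‖z‖ ≤ ‖z - c • w‖ := by
        rw [norm_sub_rev]; exact norm_sub_norm_le _ _
      rw [norm_smul, Real.norm_of_nonneg hc] at h1
      nlinarith [hnorm w hw]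
  refine ⟨l, hl.1, v, hv, fun c hc w hw => ?_⟩
  -- variational inequality
  have hseg : ∀ t : ℝ, 0 < t → t ≤ 1 → ‖z - l • v‖ ≤ ‖z - l • v - t • (c • w - l • v)‖ := by
    intro t ht ht1
    have e : ∃ c' : ℝ, 0 ≤ c' ∧ ∃ w' ∈ S, l • v + t • (c • w - l • v) = c' • w' := by
      refine ⟨(1 - t) * l + t * c, by have := hl.1; have : 0 ≤ 1 - t := by linarith
                                      positivity, ?_⟩
      have hl0 := hl.1
      have ht' : 0 ≤ 1 - t := by linarith
      rcases eq_or_lt_of_le (show 0 ≤ (1 - t) * l + t * c by positivity) with h | h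
      · have h1 : (1 - t) * l = 0 := by nlinarith [mul_nonneg ht' hl0, mul_nonneg ht.le hc]
        have h2 : t * c = 0 := by nlinarith [mul_nonneg ht' hl0, mul_nonneg ht.le hc]
        refine ⟨v, hv, ?_⟩
        have : l • v + t • (c • w - l • v) = ((1-t)*l) • v + (t*c) • w := by module
        rw [this, h1, h2]; simp
      · refine ⟨(((1 - t) * l)/((1 - t) * l + t * c)) • v + ((t * c)/((1 - t) * l + t * c)) • w,
          hconv hv hw (by positivity) (by positivity) (by field_simp), ?_⟩
        rw [smul_add, smul_smul, smul_smul, mul_div_cancel₀ _ h.ne', mul_div_cancel₀ _ h.ne']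
        module
    obtain ⟨c', hc', w', hw', e⟩ := e
    have := hmin' c' hc' w' hw'
    rw [← e] at this
    rwa [sub_sub]
  by_contra hcon
  push Not at hcon
  set a := z - l • v
  set b := c • w - l • v
  have hb : 0 < ‖b‖ := by
    rw [norm_pos_iff]; intro h; rw [h] at hcon; simp at hcon
  set i := inner ℝ a b with hi
  have hsq : ∀ t : ℝ, 0 < t → t ≤ 1 → 2 * i ≤ t * ‖b‖ ^ 2 := by
    intro t ht ht1
    have h1 := hseg t ht ht1
    have h2 := norm_sub_sq_real a (t • b)
    rw [inner_smul_right, norm_smul, Real.norm_of_nonneg ht.le] at h2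
    have h3 : ‖a‖ ^ 2 ≤ ‖a - t • b‖ ^ 2 := by gcongr
    have : t * (2 * i) ≤ t * (t * ‖b‖ ^ 2) := by nlinarith
    exact le_of_mul_le_mul_left this ht
  have h1 := hsq (min 1 (i / ‖b‖ ^ 2)) (by positivity) (min_le_left _ _)
  have h2 : min 1 (i / ‖b‖ ^ 2) * ‖b‖ ^ 2 ≤ i := by
    calc _ ≤ i / ‖b‖ ^ 2 * ‖b‖ ^ 2 := by gcongr; exact min_le_right _ _
      _ = i := by field_simp
  linarith

theorem cone_min {S : Set E} {z p : E} (h : ∀ c : ℝ, 0 ≤ c → ∀ w ∈ S, inner ℝ (z - p) (c • w - p) ≤ 0)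
    (c : ℝ) (hc : 0 ≤ c) (w : E) (hw : w ∈ S) : ‖z - p‖ ^ 2 + ‖c • w - p‖ ^ 2 ≤ ‖z - c • w‖ ^ 2 := by
  have h1 := h c hc w hw
  have e : z - c • w = (z - p) - (c • w - p) := by abel
  rw [e, norm_sub_sq_real (z - p)]
  linarith

theorem cone_lip {S : Set E} {v0 : E} (hv0 : v0 ≠ 0) (hS : ∀ v ∈ S, inner ℝ v v0 = ‖v0‖ ^ 2)
    {z z' v v' : E} {l l' : ℝ} (hl : 0 ≤ l) (hl' : 0 ≤ l') (hv : v ∈ S) (hv' : v' ∈ S)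
    (h : ∀ c : ℝ, 0 ≤ c → ∀ w ∈ S, inner ℝ (z - l • v) (c • w - l • v) ≤ 0)
    (h' : ∀ c : ℝ, 0 ≤ c → ∀ w ∈ S, inner ℝ (z' - l' • v') (c • w - l' • v') ≤ 0) :
    |l - l'| ≤ ‖v0‖⁻¹ * ‖z - z'‖ := by
  have hpos : 0 < ‖v0‖ := norm_pos_iff.2 hv0
  have h1 := h l' hl' v' hv'
  have h2 := h' l hl v hv
  set p := l • v with hp
  set p' := l' • v' with hp'
  have h3 : ‖p - p'‖ ^ 2 ≤ inner ℝ (z - z') (p - p') := by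
    rw [← real_inner_self_eq_norm_sq]
    have : inner ℝ (p - p') (p - p') - inner ℝ (z - z') (p - p') = inner ℝ (z - p) (p' - p) + inner ℝ (z' - p') (p - p') := by
      simp only [inner_sub_left, inner_sub_right]; ring
    linarith
  have h4 : ‖p - p'‖ ≤ ‖z - z'‖ := by
    have := real_inner_le_norm (z - z') (p - p')
    by_contra hcon
    push Not at hcon
    nlinarith [norm_nonneg (z - z'), norm_nonneg (p - p')]
  have h5 : inner ℝ (p - p') v0 = (l - l') * ‖v0‖ ^ 2 := by
    rw [inner_sub_left, hp, hp', real_inner_smul_left, real_inner_smul_left, hS v hv, hS v' hv']; ring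
  have h6 := abs_real_inner_le_norm (p - p') v0
  rw [h5, abs_mul, abs_of_pos (by positivity : 0 < ‖v0‖^2)] at h6
  have h7 : |l - l'| * ‖v0‖ ≤ ‖p - p'‖ := by
    have : (|l - l'| * ‖v0‖) * ‖v0‖ ≤ ‖p - p'‖ * ‖v0‖ := by nlinarith
    exact le_of_mul_le_mul_right this hpos
  rw [inv_mul_eq_div, le_div_iff₀ hpos]
  linarith
end D

/-- final probabilistic combination -/
theorem prob_combine {Ω : Type*} [MeasurableSpace Ω] (P : Measure Ω) [IsProbabilityMeasure P]
    {f d L : Ω → ℝ} (hf : MemLp f 2 P) (hd : MemLp d 2 P) (hL : MemLp L 2 P) {b c : ℝ} (hb : 0 < b)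
    (hc : 0 ≤ c) (hf0 : ∀ x, 0 ≤ f x)
    (vf : Var[f; P] ≤ 4/3) (vd : Var[d; P] ≤ 4/3) (vL : Var[L; P] ≤ 4/3 * b^2)
    (hA : ∀ x, |L x - ∫ y, L y ∂P| ≤ 2 * b → f x ≤ d x + c) :
    ∫ x, f x ^ 2 ∂P ≤ 4 + (Real.sqrt (∫ x, d x ^ 2 ∂P) + c + 2) ^ 2 := by
  have ef : Var[f; P] = ∫ x, f x ^ 2 ∂P - (∫ x, f x ∂P) ^ 2 := variance_eq_sub hf
  have ed : Var[d; P] = ∫ x, d x ^ 2 ∂P - (∫ x, d x ∂P) ^ 2 := variance_eq_sub hd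
  have hdJ : ∫ x, d x ∂P ≤ Real.sqrt (∫ x, d x ^ 2 ∂P) := by
    apply Real.le_sqrt_of_sq_le
    have := variance_nonneg d P
    linarith
  have hf1 : Integrable f P := hf.integrable (by norm_num)
  have hd1 : Integrable d P := hd.integrable (by norm_num)
  have hL1 : Integrable L P := hL.integrable (by norm_num)
  set mf := ∫ x, f x ∂P with hmf
  set md := ∫ x, d x ∂P with hmd
  set mL := ∫ x, L x ∂P with hmL
  have hmf0 : 0 ≤ mf := integral_nonneg hf0
  have hm : mf - md - c ≤ 2 := by
    by_contra hcon
    push Not at hcon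
    set m := mf - md - c
    have i1 : Integrable (fun x => (f x - mf) ^ 2) P := (hf.sub (memLp_const mf)).integrable_sq
    have i2 : Integrable (fun x => (d x - md) ^ 2) P := (hd.sub (memLp_const md)).integrable_sq
    have i3 : Integrable (fun x => (L x - mL) ^ 2) P := (hL.sub (memLp_const mL)).integrable_sq
    have e1 : Var[f; P] = ∫ x, (f x - mf) ^ 2 ∂P := variance_eq_integral hf.aemeasurable
    have e2 : Var[d; P] = ∫ x, (d x - md) ^ 2 ∂P := variance_eq_integral hd.aemeasurable
    have e3 : Var[L; P] = ∫ x, (L x - mL) ^ 2 ∂P := variance_eq_integral hL.aemeasurable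
    have hpt : ∀ x, f x - d x ≤ (c + (1/4) * (f x - mf) ^ 2) + ((1/4) * (d x - md) ^ 2 + ((m + 2) / (4 * b ^ 2)) * (L x - mL) ^ 2) := by
      intro x
      by_cases h : |L x - mL| ≤ 2 * b
      · have := hA x h
        have : 0 ≤ ((m + 2) / (4 * b ^ 2)) * (L x - mL) ^ 2 := by positivity
        nlinarith [sq_nonneg (f x - mf), sq_nonneg (d x - md)]
      · push Not at h
        have h1 : 4 * b ^ 2 ≤ (L x - mL) ^ 2 := by
          rw [← sq_abs (L x - mL)]; nlinarith
        have h2 : m + 2 ≤ ((m + 2) / (4 * b ^ 2)) * (L x - mL) ^ 2 := by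
          rw [div_mul_eq_mul_div, le_div_iff₀ (by positivity)]
          gcongr
        nlinarith [sq_nonneg (f x - mf - 2), sq_nonneg (d x - md + 2)]
    have hI := integral_mono (hf1.sub hd1) (((integrable_const c).add (i1.const_mul (1/4))).add
      ((i2.const_mul (1/4)).add (i3.const_mul ((m + 2) / (4 * b ^ 2))))) hpt
    have r1 : ∫ x, (f - d) x ∂P = mf - md := integral_sub hf1 hd1
    rw [r1, integral_add' ((integrable_const c).add (i1.const_mul (1/4))) ((i2.const_mul (1/4)).add (i3.const_mul ((m + 2) / (4 * b ^ 2)))),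
      integral_add' (integrable_const c) (i1.const_mul (1/4)), integral_add' (i2.const_mul (1/4)) (i3.const_mul ((m + 2) / (4 * b ^ 2))),
      integral_const_mul, integral_const_mul, integral_const_mul, ← e1, ← e2, ← e3] at hI
    have h5 : (m + 2) / (4 * b ^ 2) * Var[L; P] ≤ (m + 2) / 3 := by
      calc _ ≤ (m + 2) / (4 * b ^ 2) * (4/3 * b^2) := by gcongr
        _ = _ := by field_simp
    simp at hI
    have : m = mf - md - c := rfl
    linarith
  have : mf ≤ Real.sqrt (∫ x, d x ^ 2 ∂P) + c + 2 := by linarith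
  nlinarith

section M
variable {E : Type*} [NormedAddCommGroup E] [InnerProductSpace ℝ E]

/-- The variational characterisation of `l • v` as the projection of `z` onto the cone. -/
def IsCP (S : Set E) (z : E) (l : ℝ) (v : E) : Prop :=
  0 ≤ l ∧ v ∈ S ∧ ∀ c : ℝ, 0 ≤ c → ∀ w ∈ S, inner ℝ (z - l • v) (c • w - l • v) ≤ 0

theorem IsCP.norm_le {S : Set E} {z v : E} {l : ℝ} (h : IsCP S z l v) (c : ℝ) (hc : 0 ≤ c) (w : E)
    (hw : w ∈ S) : ‖z - l • v‖ ≤ ‖z - c • w‖ := by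
  have := cone_min h.2.2 c hc w hw
  refine le_of_sq_le_sq ?_ (norm_nonneg _)
  nlinarith [sq_nonneg ‖c • w - l • v‖]

theorem infDist_attained {S : Set E} (hcomp : IsCompact S) (hne : S.Nonempty) (z : E) (c : ℝ) :
    ∃ w ∈ S, Metric.infDist z ((fun x => c • x) '' S) = ‖z - c • w‖ := by
  have h1 : IsCompact ((fun x => c • x) '' S) := hcomp.image (by fun_prop)
  obtain ⟨y, ⟨w, hw, rfl⟩, h⟩ := h1.exists_infDist_eq_dist (hne.image _) z
  exact ⟨w, hw, by rw [h, dist_eq_norm]⟩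

theorem infDist_scale_le {S : Set E} (z : E) (c : ℝ) {w : E} (hw : w ∈ S) :
    Metric.infDist z ((fun x => c • x) '' S) ≤ ‖z - c • w‖ := by
  rw [← dist_eq_norm]
  exact Metric.infDist_le_dist_of_mem ⟨w, hw, rfl⟩

theorem IsCP.isMin {S : Set E} (hcomp : IsCompact S) {z v : E} {l : ℝ} (h : IsCP S z l v) (c : ℝ)
    (hc : 0 ≤ c) :
    Metric.infDist z ((fun x => l • x) '' S) ≤ Metric.infDist z ((fun x => c • x) '' S) := by
  obtain ⟨w, hw, e⟩ := infDist_attained hcomp ⟨v, h.2.1⟩ z c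
  rw [e]
  exact (infDist_scale_le z l h.2.1).trans (h.norm_le c hc w hw)

theorem IsCP.unique {S : Set E} (hcomp : IsCompact S) {v0 : E} (hv0 : v0 ≠ 0)
    (hS : ∀ v ∈ S, inner ℝ v v0 = ‖v0‖ ^ 2) {z v : E} {l : ℝ} (h : IsCP S z l v) (c : ℝ)
    (hc : 0 ≤ c)
    (hle : Metric.infDist z ((fun x => c • x) '' S) ≤ Metric.infDist z ((fun x => l • x) '' S)) :
    c = l := by
  obtain ⟨w, hw, e⟩ := infDist_attained hcomp ⟨v, h.2.1⟩ z c
  have h1 := hle.trans (infDist_scale_le z l h.2.1)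
  rw [e] at h1
  have h2 := cone_min h.2.2 c hc w hw
  have h3 : ‖z - c • w‖ ^ 2 ≤ ‖z - l • v‖ ^ 2 := by gcongr
  have h4 : ‖c • w - l • v‖ = 0 := by
    have : ‖c • w - l • v‖ ^ 2 = 0 := le_antisymm (by linarith) (sq_nonneg _)
    exact pow_eq_zero_iff (two_ne_zero) |>.1 this
  have h5 : c • w = l • v := sub_eq_zero.1 (norm_eq_zero.1 h4)
  have h6 : inner ℝ (c • w) v0 = inner ℝ (l • v) v0 := by rw [h5]
  rw [real_inner_smul_left, real_inner_smul_left, hS w hw, hS v h.2.1] at h6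
  have : 0 < ‖v0‖ := norm_pos_iff.2 hv0
  exact mul_right_cancel₀ (by positivity) h6

theorem IsCP.shift {S : Set E} (hconv : Convex ℝ S) {z v vs : E} {l lam : ℝ} (h : IsCP S z l v)
    (hvs : vs ∈ S) (hlam : 0 < lam) (hl : l ≤ lam) {K : Set E}
    (hK : K = {y | ∃ c : ℝ, 0 ≤ c ∧ ∃ w ∈ S, y = c • w}) :
    Metric.infDist z ((fun x => lam • x) '' S) ≤ Metric.infDist z K + (lam - l) * ‖vs‖ := by
  have hl0 := h.1
  have hu : (l / lam) • v + (1 - l / lam) • vs ∈ S :=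
    hconv h.2.1 hvs (by positivity) (by rw [sub_nonneg, div_le_one hlam]; exact hl) (by ring)
  have e : z - lam • ((l / lam) • v + (1 - l / lam) • vs) = (z - l • v) - (lam - l) • vs := by
    have h1 : lam * (l / lam) = l := by field_simp
    have h2 : lam * (1 - l / lam) = lam - l := by field_simp
    rw [smul_add, smul_smul, smul_smul, h1, h2]
    abel
  have h1 := infDist_scale_le z lam hu
  rw [e] at h1
  have h2 := norm_sub_le (z - l • v) ((lam - l) • vs)
  rw [norm_smul, Real.norm_of_nonneg (by linarith)] at h2
  have h3 : ‖z - l • v‖ ≤ Metric.infDist z K := by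
    have hne : K.Nonempty := by rw [hK]; exact ⟨_, l, hl0, v, h.2.1, rfl⟩
    rw [Metric.le_infDist hne]
    intro y hy
    rw [hK] at hy
    obtain ⟨c, hc, w, hw, rfl⟩ := hy
    rw [dist_eq_norm]
    exact h.norm_le c hc w hw
  linarith

variable [FiniteDimensional ℝ E] [MeasurableSpace E] [BorelSpace E]

theorem cone_L_lip {S : Set E} {v0 : E} (hv0 : v0 ≠ 0)
    (hS : ∀ v ∈ S, inner ℝ v v0 = ‖v0‖ ^ 2) {L : E → ℝ} {V : E → E}
    (hLV : ∀ z, IsCP S z (L z) (V z)) : LipschitzWith (‖v0‖₊⁻¹) L := by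
  refine LipschitzWith.of_dist_le_mul fun z z' => ?_
  rw [Real.dist_eq, dist_eq_norm]
  have := cone_lip hv0 hS (hLV z).1 (hLV z').1 (hLV z).2.1 (hLV z').2.1 (hLV z).2.2 (hLV z').2.2
  simpa using this

theorem E_main (μ : Measure E) [μ.IsAddHaarMeasure] (hac : stdGaussian E ≪ μ)
    {S : Set E} (hconv : Convex ℝ S) {v0 : E} (hv0 : v0 ≠ 0)
    (hS : ∀ v ∈ S, inner ℝ v v0 = ‖v0‖ ^ 2) {L : E → ℝ} {V : E → E}
    (hLV : ∀ z, IsCP S z (L z) (V z)) {lam lamstar : ℝ}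
    (hst : lamstar = (∫ z, L z ∂stdGaussian E) + 2 / ‖v0‖) (hlam : lamstar ≤ lam) {vs : E}
    (hvs : vs ∈ S) {K : Set E}
    (hK : K = {y | ∃ c : ℝ, 0 ≤ c ∧ ∃ w ∈ S, y = c • w}) :
    ∫ z, Metric.infDist z ((fun x => lam • x) '' S) ^ 2 ∂stdGaussian E ≤
      4 + (Real.sqrt (∫ z, Metric.infDist z K ^ 2 ∂stdGaussian E) +
        (4 * ‖vs‖ / ‖v0‖ + (lam - lamstar) * ‖vs‖) + 2) ^ 2 := by
  have hpos : 0 < ‖v0‖ := norm_pos_iff.2 hv0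
  have hLl := cone_L_lip hv0 hS hLV
  have h1 := Metric.lipschitz_infDist_pt ((fun x => lam • x) '' S)
  have h2 := Metric.lipschitz_infDist_pt K
  have hmean : 0 ≤ ∫ z, L z ∂stdGaussian E := integral_nonneg fun z => (hLV z).1
  have hlam0 : 0 < lam := by
    have : 0 < 2 / ‖v0‖ := by positivity
    linarith
  refine prob_combine (stdGaussian E) (lip_memLp _ h1) (lip_memLp _ h2) (lip_memLp _ hLl)
    (b := ‖v0‖⁻¹) (by positivity) ?_ (fun x => Metric.infDist_nonneg) ?_ ?_ ?_ ?_
  · have : 0 ≤ lam - lamstar := by linarith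
    positivity
  · simpa using poincare_var μ hac h1
  · simpa using poincare_var μ hac h2
  · simpa using poincare_var μ hac hLl
  · intro x hx
    have hx' := abs_le.1 hx
    have e2 : 2 / ‖v0‖ = 2 * ‖v0‖⁻¹ := by ring
    rw [e2] at hst
    have := (hLV x).shift hconv hvs hlam0 (by linarith) hK
    refine this.trans ?_
    have h5 : (lam - L x) * ‖vs‖ ≤ (4 * ‖v0‖⁻¹ + (lam - lamstar)) * ‖vs‖ := by
      gcongr
      linarith
    have e4 : 4 * ‖vs‖ / ‖v0‖ + (lam - lamstar) * ‖vs‖ = (4 * ‖v0‖⁻¹ + (lam - lamstar)) * ‖vs‖ := by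
      ring
    rw [e4]
    linarith
end M

section T

theorem eunorm_eq {n : ℕ} (x : Fin n → ℝ) : eunorm x = ‖WithLp.toLp 2 x‖ := by
  rw [EuclideanSpace.norm_eq]
  simp [eunorm, sqnorm]

theorem distSet_eq {n : ℕ} (z : Fin n → ℝ) (A : Set (Fin n → ℝ)) :
    distSet z A = Metric.infDist (WithLp.toLp 2 z) (WithLp.toLp 2 '' A) := by
  rw [Metric.infDist_eq_iInf, ← sInf_image', Set.image_image]
  unfold distSet
  congr 1
  refine Set.image_congr fun v _ => ?_
  rw [eunorm_eq, dist_eq_norm, WithLp.toLp_sub]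

theorem image_scale {n : ℕ} (c : ℝ) (A : Set (Fin n → ℝ)) :
    WithLp.toLp 2 '' scaleSet c A = (fun x : EuclideanSpace ℝ (Fin n) => c • x) '' (WithLp.toLp 2 '' A) := by
  unfold scaleSet
  rw [Set.image_image, Set.image_image]
  rfl

theorem image_cone {n : ℕ} (A : Set (Fin n → ℝ)) :
    WithLp.toLp 2 '' coneOf A =
      {y : EuclideanSpace ℝ (Fin n) | ∃ c : ℝ, 0 ≤ c ∧ ∃ w ∈ WithLp.toLp 2 '' A, y = c • w} := by
  ext y
  constructor
  · rintro ⟨x, hx, rfl⟩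
    simp only [coneOf, Set.mem_iUnion] at hx
    obtain ⟨c, hc, v, hv, rfl⟩ := hx
    exact ⟨c, hc, _, ⟨v, hv, rfl⟩, rfl⟩
  · rintro ⟨c, hc, _, ⟨v, hv, rfl⟩, rfl⟩
    refine ⟨c • v, ?_, rfl⟩
    simp only [coneOf, Set.mem_iUnion]
    exact ⟨c, hc, v, hv, rfl⟩

theorem gauss_mp (n : ℕ) : MeasurePreserving (WithLp.toLp 2 : (Fin n → ℝ) → EuclideanSpace ℝ (Fin n))
    (gaussVec n 1) (stdGaussian (EuclideanSpace ℝ (Fin n))) := by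
  refine ⟨by fun_prop, ?_⟩
  rw [← map_pi_eq_stdGaussian]
  simp [gaussVec]

theorem gauss_int {n : ℕ} {F : EuclideanSpace ℝ (Fin n) → ℝ} (hF : Continuous F) :
    ∫ z, F (WithLp.toLp 2 z) ∂gaussVec n 1 = ∫ y, F y ∂stdGaussian (EuclideanSpace ℝ (Fin n)) := by
  rw [← (gauss_mp n).map_eq, integral_map (gauss_mp n).aemeasurable hF.aestronglyMeasurable]

theorem gaussMSD_eq {n : ℕ} (A : Set (Fin n → ℝ)) :
    gaussMSD A = ∫ y, Metric.infDist y (WithLp.toLp 2 '' A) ^ 2 ∂stdGaussian (EuclideanSpace ℝ (Fin n)) := by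
  unfold gaussMSD
  simp_rw [distSet_eq]
  exact gauss_int (F := fun y => Metric.infDist y (WithLp.toLp 2 '' A) ^ 2)
    ((Metric.continuous_infDist_pt _).pow 2)

theorem subdiff_compact {n : ℕ} (g : (Fin n → ℝ) → ℝ) (θ : Fin n → ℝ) : IsCompact (subdiff g θ) := by
  refine Metric.isCompact_of_isClosed_isBounded ?_ ?_
  · have : subdiff g θ = ⋂ y, {v | g θ + ∑ i, v i * (y i - θ i) ≤ g y} := by
      ext v; simp [subdiff]
    rw [this]
    refine isClosed_iInter fun y => isClosed_le (by fun_prop) continuous_const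
  · refine (Metric.isBounded_Icc (fun i => g θ - g (θ - Pi.single i 1))
      (fun i => g (θ + Pi.single i 1) - g θ)).subset ?_
    intro v hv
    refine ⟨fun i => ?_, fun i => ?_⟩
    · have := hv (θ - Pi.single i 1)
      simp [Pi.single_apply] at this
      linarith
    · have := hv (θ + Pi.single i 1)
      simp [Pi.single_apply] at this
      linarith

theorem subdiff_convex {n : ℕ} (g : (Fin n → ℝ) → ℝ) (θ : Fin n → ℝ) : Convex ℝ (subdiff g θ) := by
  intro v hv w hw a b ha hb hab y
  have h1 := hv y
  have h2 := hw y
  have e : ∑ i, (a • v + b • w) i * (y i - θ i) =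
      a * ∑ i, v i * (y i - θ i) + b * ∑ i, w i * (y i - θ i) := by
    rw [Finset.mul_sum, Finset.mul_sum, ← Finset.sum_add_distrib]
    refine Finset.sum_congr rfl fun i _ => ?_
    simp; ring
  rw [e]
  have hb' : b = 1 - a := by linarith
  subst hb'
  nlinarith

theorem minNorm_inner {n : ℕ} {A : Set (Fin n → ℝ)} {v0 : Fin n → ℝ}
    (h : IsMinNormIn v0 (affineSpan ℝ A : Set (Fin n → ℝ))) {v : Fin n → ℝ} (hv : v ∈ A) :
    inner ℝ (WithLp.toLp 2 v) (WithLp.toLp 2 v0) = ‖WithLp.toLp 2 v0‖ ^ 2 := by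
  set x := WithLp.toLp 2 v with hx
  set x0 := WithLp.toLp 2 v0 with hx0
  have key : ∀ t : ℝ, 0 ≤ 2 * t * inner ℝ x0 (x - x0) + t ^ 2 * ‖x - x0‖ ^ 2 := by
    intro t
    have hm : AffineMap.lineMap v0 v t ∈ affineSpan ℝ A :=
      AffineMap.lineMap_mem t h.1 (subset_affineSpan ℝ A hv)
    have h1 := h.2 _ hm
    rw [eunorm_eq, eunorm_eq] at h1
    have e : WithLp.toLp 2 (AffineMap.lineMap v0 v t : Fin n → ℝ) = x0 + t • (x - x0) := by
      rw [AffineMap.lineMap_apply]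
      simp [hx, hx0, add_comm]
    rw [e] at h1
    have h2 : ‖x0‖ ^ 2 ≤ ‖x0 + t • (x - x0)‖ ^ 2 := by gcongr
    rw [norm_add_sq_real x0, inner_smul_right, norm_smul, mul_pow, Real.norm_eq_abs, sq_abs] at h2
    linarith
  have hz : inner ℝ x0 (x - x0) = 0 := by
    set i := inner ℝ x0 (x - x0)
    set q := ‖x - x0‖ ^ 2 with hq
    have hq0 : 0 ≤ q := sq_nonneg _
    have h1 := key (-i / (q + 1))
    have h2 : 2 * (-i / (q + 1)) * i + (-i / (q + 1)) ^ 2 * q = -(i ^ 2 * (q + 2)) / (q + 1) ^ 2 := by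
      field_simp; ring
    rw [h2, le_div_iff₀ (by positivity)] at h1
    have : i ^ 2 = 0 := by nlinarith [sq_nonneg i]
    exact pow_eq_zero_iff two_ne_zero |>.1 this
  rw [inner_sub_right, real_inner_self_eq_norm_sq] at hz
  rw [real_inner_comm]
  linarith

end T

/-- Proposition: Gaussian mean squared distance bound for general convex
penalties. -/
theorem stmt12 (n : ℕ) (g : (Fin n → ℝ) → ℝ) (hg : ConvexOn ℝ Set.univ g)
    (θ : Fin n → ℝ) (v0 : Fin n → ℝ)
    (hv0 : IsMinNormIn v0 ((affineSpan ℝ (subdiff g θ) : Set (Fin n → ℝ))))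
    (hv0ne : v0 ≠ 0) :
    (∀ z : Fin n → ℝ, ∃! l : ℝ, 0 ≤ l ∧ ∀ μ : ℝ, 0 ≤ μ →
        distSet z (scaleSet l (subdiff g θ)) ≤ distSet z (scaleSet μ (subdiff g θ))) ∧
      ∀ lamfun : (Fin n → ℝ) → ℝ, IsLamFun (subdiff g θ) lamfun →
        Integrable lamfun (gaussVec n 1) ∧
          ∀ lamstar : ℝ, lamstar = (∫ z, lamfun z ∂gaussVec n 1) + 2 / eunorm v0 →
            ∀ lam : ℝ, lamstar ≤ lam → ∀ vstar ∈ subdiff g θ,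
              gaussMSD (scaleSet lam (subdiff g θ)) ≤
                4 + (Real.sqrt (gaussMSD (coneOf (subdiff g θ))) +
                  4 * eunorm vstar / eunorm v0 + 2 + (lam - lamstar) * eunorm vstar) ^ 2 := by
  set T := subdiff g θ with hT
  set S : Set (EuclideanSpace ℝ (Fin n)) := WithLp.toLp 2 '' T with hSdef
  have hTc : IsCompact T := subdiff_compact g θ
  have hSc : IsCompact S := hTc.image (by fun_prop)
  have hTne : T.Nonempty := (affineSpan_nonempty ℝ).1 ⟨v0, hv0.1⟩
  have hSne : S.Nonempty := hTne.image _
  have hSconv : Convex ℝ S :=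
    (subdiff_convex g θ).linear_image (WithLp.linearEquiv 2 ℝ (Fin n → ℝ)).symm.toLinearMap
  have hx0 : (WithLp.toLp 2 v0 : EuclideanSpace ℝ (Fin n)) ≠ 0 := by
    intro h
    exact hv0ne ((WithLp.toLp_eq_zero 2).1 h)
  have hin : ∀ v ∈ S, inner ℝ v (WithLp.toLp 2 v0) = ‖WithLp.toLp 2 v0‖ ^ 2 := by
    rintro _ ⟨v, hv, rfl⟩
    exact minNorm_inner hv0 hv
  have hex : ∀ z, ∃ l v, IsCP S z l v := by
    intro z
    obtain ⟨l, hl, v, hv, h⟩ := cone_facts hSc hSne hSconv hx0 hin z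
    exact ⟨l, v, hl, hv, h⟩
  choose L V hLV using hex
  have hd : ∀ (z : Fin n → ℝ) (c : ℝ), distSet z (scaleSet c T) =
      Metric.infDist (WithLp.toLp 2 z) ((fun x : EuclideanSpace ℝ (Fin n) => c • x) '' S) := by
    intro z c
    rw [distSet_eq, image_scale]
  have hmin : ∀ z : Fin n → ℝ, ∀ c : ℝ, 0 ≤ c →
      distSet z (scaleSet (L (WithLp.toLp 2 z)) T) ≤ distSet z (scaleSet c T) := by
    intro z c hc
    rw [hd, hd]
    exact (hLV _).isMin hSc c hc
  have huniq : ∀ z : Fin n → ℝ, ∀ c : ℝ, (0 ≤ c ∧ ∀ μ : ℝ, 0 ≤ μ →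
      distSet z (scaleSet c T) ≤ distSet z (scaleSet μ T)) → c = L (WithLp.toLp 2 z) := by
    rintro z c ⟨hc, h⟩
    have := h (L (WithLp.toLp 2 z)) (hLV _).1
    rw [hd, hd] at this
    exact (hLV _).unique hSc hx0 hin c hc this
  have hlip := cone_L_lip hx0 hin hLV
  refine ⟨fun z => ⟨L (WithLp.toLp 2 z), ⟨(hLV _).1, hmin z⟩, fun c hc => huniq z c hc⟩, ?_⟩
  intro lamfun hlf
  have hfun : lamfun = fun z => L (WithLp.toLp 2 z) := funext fun z => huniq z _ (hlf z)
  subst hfun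
  refine ⟨?_, ?_⟩
  · have : Integrable L (stdGaussian (EuclideanSpace ℝ (Fin n))) :=
      (lip_memLp _ hlip).integrable (by norm_num)
    exact (gauss_mp n).integrable_comp_of_integrable this
  · intro lamstar hst lam hlam vstar hvs
    rw [gauss_int hlip.continuous, eunorm_eq] at hst
    have := E_main volume (std_ac n) hSconv hx0 hin hLV hst hlam
      (vs := WithLp.toLp 2 vstar) ⟨vstar, hvs, rfl⟩ (image_cone T)
    rw [gaussMSD_eq, gaussMSD_eq, image_scale, eunorm_eq, eunorm_eq]
    refine this.trans (le_of_eq ?_)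
    ring
end
end

section
/- Fix an integer r ≥ 1. There exists a constant C_r > 0 depending only on r such that for every n ≥ r, every σ > 0, every t ≥ 0 and every V ≥ 0, with ξ ∼ N_n(0, σ²I_n), E[ sup over θ ∈ S_r(V, t) of ⟨ξ, θ⟩ ] ≤ C_r σ t (√n · V / t)^{1/(2r)} + C_r σ t sqrt(log(en)), where S_r(V, t) := {θ ∈ ℝ^n : ‖θ‖ ≤ t, ‖D^{(r)}θ‖₁ ≤ V n^{1−r}}. -/
open MeasureTheory ProbabilityTheory
open scoped BigOperators

noncomputable section

/-! ## Finite differences -/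

lemma dseq_iter_succ (r : ℕ) (f : ℕ → ℝ) (s : ℕ) :
    dseq^[r + 1] f s = dseq^[r] f (s + 1) - dseq^[r] f s := by
  rw [Function.iterate_succ_apply']; rfl

lemma dseq_iter_congr (r : ℕ) (f g : ℕ → ℝ) (s : ℕ) (h : ∀ k ≤ r, f (s + k) = g (s + k)) :
    dseq^[r] f s = dseq^[r] g s := by
  induction r generalizing s with
  | zero => simpa using h 0 le_rfl
  | succ r ih =>
    rw [dseq_iter_succ, dseq_iter_succ, ih s (fun k hk => h k (by omega)),
      ih (s + 1) (fun k hk => by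
        have := h (k + 1) (by omega)
        rwa [show s + 1 + k = s + (k + 1) by ring])]

lemma dseq_iter_zero (r : ℕ) (s : ℕ) : dseq^[r] (fun _ => (0 : ℝ)) s = 0 := by
  induction r generalizing s with
  | zero => rfl
  | succ r ih => rw [dseq_iter_succ, ih, ih, sub_zero]

lemma dseq_iter_add (r : ℕ) (f g : ℕ → ℝ) (s : ℕ) :
    dseq^[r] (fun i => f i + g i) s = dseq^[r] f s + dseq^[r] g s := by
  induction r generalizing s with
  | zero => rfl
  | succ r ih => rw [dseq_iter_succ, dseq_iter_succ, dseq_iter_succ, ih, ih]; ring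

lemma dseq_iter_smul (r : ℕ) (c : ℝ) (f : ℕ → ℝ) (s : ℕ) :
    dseq^[r] (fun i => c * f i) s = c * dseq^[r] f s := by
  induction r generalizing s with
  | zero => rfl
  | succ r ih => rw [dseq_iter_succ, dseq_iter_succ, ih, ih]; ring

lemma dseq_iter_shift (r a : ℕ) (f : ℕ → ℝ) (s : ℕ) :
    dseq^[r] (fun i => f (i + a)) s = dseq^[r] f (s + a) := by
  induction r generalizing s with
  | zero => rfl
  | succ r ih =>
    rw [dseq_iter_succ, dseq_iter_succ, ih, ih, show s + 1 + a = s + a + 1 by ring]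

lemma dseq_iter_last (r : ℕ) (f : ℕ → ℝ) (s : ℕ) (h : ∀ k < r, f (s + k) = 0) :
    dseq^[r] f s = f (s + r) := by
  induction r generalizing s with
  | zero => rfl
  | succ r ih =>
    rw [dseq_iter_succ, ih s (fun k hk => h k (by omega)),
      ih (s + 1) (fun k hk => by
        have := h (k + 1) (by omega)
        rwa [show s + 1 + k = s + (k + 1) by ring]), h r (by omega), sub_zero]
    congr 1; ring

/-- Discrete Taylor expansion with remainder bound. -/
lemma taylor_exists (r : ℕ) : ∀ f : ℕ → ℝ, ∃ p : ℕ → ℝ, (∀ s, dseq^[r + 1] p s = 0) ∧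
    ∀ s, |f s - p s| ≤ (s : ℝ) ^ r * ∑ u ∈ Finset.range (s - r), |dseq^[r + 1] f u| := by
  induction r with
  | zero =>
    intro f
    refine ⟨fun _ => f 0, fun s => by simp [dseq], fun s => ?_⟩
    simp only [pow_zero, one_mul, Nat.sub_zero]
    have := Finset.sum_range_sub f s
    rw [← this]
    exact Finset.abs_sum_le_sum_abs _ _
  | succ r ih =>
    intro f
    obtain ⟨q, hq, hb⟩ := ih (dseq f)
    refine ⟨fun s => f 0 + ∑ v ∈ Finset.range s, q v, fun s => ?_, fun s => ?_⟩
    · rw [Function.iterate_succ_apply]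
      have : dseq (fun s => f 0 + ∑ v ∈ Finset.range s, q v) = q := by
        funext s; simp [dseq, Finset.sum_range_succ]
      rw [this]; exact hq s
    · have h1 : f s - (f 0 + ∑ v ∈ Finset.range s, q v)
          = ∑ v ∈ Finset.range s, (dseq f v - q v) := by
        rw [Finset.sum_sub_distrib]
        have := Finset.sum_range_sub f s
        simp only [dseq]
        rw [this]; ring
      rw [h1]
      refine (Finset.abs_sum_le_sum_abs _ _).trans ?_
      have h2 : ∀ v ∈ Finset.range s, |dseq f v - q v| ≤
          (s : ℝ) ^ r * ∑ u ∈ Finset.range (s - (r + 1)), |dseq^[r + 1 + 1] f u| := by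
        intro v hv
        have hv := Finset.mem_range.1 hv
        refine (hb v).trans ?_
        gcongr
        · simp only [← Function.iterate_succ_apply]
          exact Finset.sum_le_sum_of_subset_of_nonneg
            (Finset.range_mono (by omega)) (fun _ _ _ => abs_nonneg _)
      refine (Finset.sum_le_sum h2).trans ?_
      rw [Finset.sum_const, Finset.card_range, nsmul_eq_mul, pow_succ]
      apply le_of_eq; ring

/-! ## Dyadic blocks -/

/-- Index of the level-`j` dyadic block containing `i`. -/
def blk (n j i : ℕ) : ℕ := i * 2 ^ j / n

lemma blk_mono (n j : ℕ) {a b : ℕ} (h : a ≤ b) : blk n j a ≤ blk n j b :=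
  Nat.div_le_div_right (Nat.mul_le_mul_right _ h)

lemma blk_succ (n j i : ℕ) : blk n (j + 1) i / 2 = blk n j i := by
  unfold blk
  rw [Nat.div_div_eq_div_mul, pow_succ, ← mul_assoc]
  exact Nat.mul_div_mul_right _ _ (by norm_num)

lemma blk_lt (n j i : ℕ) (h : i < n) : blk n j i < 2 ^ j := by
  unfold blk
  rw [Nat.div_lt_iff_lt_mul (by omega), mul_comm]
  exact Nat.mul_lt_mul_of_pos_left h (by positivity)

lemma blk_between (n j : ℕ) {a b c : ℕ} (h1 : a ≤ b) (h2 : b ≤ c) (h : blk n j a = blk n j c) :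
    blk n j b = blk n j a :=
  le_antisymm (h ▸ blk_mono n j h2) (blk_mono n j h1)

lemma blk_width (n j : ℕ) (hn : 0 < n) {a b : ℕ} (_hab : a ≤ b) (h : blk n j a = blk n j b) :
    (b - a) * 2 ^ j < n := by
  unfold blk at h
  have h1 := Nat.div_add_mod (a * 2 ^ j) n
  have h2 := Nat.div_add_mod (b * 2 ^ j) n
  have h3 := Nat.mod_lt (b * 2 ^ j) hn
  rw [h] at h1
  rw [Nat.sub_mul]
  omega

lemma blk_card (n j l : ℕ) (hj : 2 ^ j ≤ n) :
    ((Finset.univ.filter fun i : Fin n => blk n j i = l).card : ℝ) ≤ 2 * n / 2 ^ j := by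
  have hn : 0 < n := lt_of_lt_of_le (by positivity) hj
  set S := Finset.univ.filter fun i : Fin n => blk n j i = l with hS
  rw [le_div_iff₀ (by positivity)]
  rcases S.eq_empty_or_nonempty with h | h
  · rw [h]; simp
  · have ha := S.min'_mem h
    set a := S.min' h
    have hsub : S.map Fin.valEmbedding ⊆ Finset.Ico a.1 (a.1 + ((n - 1) / 2 ^ j + 1)) := by
      intro i hi
      obtain ⟨b, hb, rfl⟩ := Finset.mem_map.1 hi
      have hab : a ≤ b := S.min'_le b hb
      have hab' : a.1 ≤ b.1 := hab
      have := blk_width n j hn hab' (by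
        rw [(Finset.mem_filter.1 ha).2, (Finset.mem_filter.1 hb).2])
      have h4 : (b.1 - a.1) ≤ (n - 1) / 2 ^ j := by
        rw [Nat.le_div_iff_mul_le (by positivity)]; omega
      simp only [Fin.valEmbedding_apply, Finset.mem_Ico]
      omega
    have hc := Finset.card_le_card hsub
    rw [Finset.card_map, Nat.card_Ico, Nat.add_sub_cancel_left] at hc
    have h5 : (n - 1) / 2 ^ j * 2 ^ j ≤ n - 1 := Nat.div_mul_le_self _ _
    have h6 : S.card * 2 ^ j ≤ 2 * n := by
      calc S.card * 2 ^ j ≤ ((n - 1) / 2 ^ j + 1) * 2 ^ j := Nat.mul_le_mul_right _ hc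
        _ ≤ 2 * n := by rw [add_mul]; omega
    exact_mod_cast h6

/-- Starter points: the first `r` points of each block. -/
def starters (r n j : ℕ) : Finset (Fin n) :=
  Finset.univ.filter fun i : Fin n => i.1 < r ∨ blk n j (i.1 - r) ≠ blk n j i.1

lemma starters_card_block (r n j l : ℕ) :
    ((starters r n j).filter fun i : Fin n => blk n j i = l).card ≤ r := by
  set S := (starters r n j).filter fun i : Fin n => blk n j i = l with hS
  rcases S.eq_empty_or_nonempty with h | h
  · rw [h]; simp
  · have ha := S.min'_mem h
    set a := S.min' h
    have hsub : S.map Fin.valEmbedding ⊆ Finset.Ico a.1 (a.1 + r) := by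
      intro i hi
      obtain ⟨b, hb, rfl⟩ := Finset.mem_map.1 hi
      have hab : a ≤ b := S.min'_le b hb
      have hab' : a.1 ≤ b.1 := hab
      have hb' := Finset.mem_filter.1 hb
      have ha' := Finset.mem_filter.1 ha
      simp only [Fin.valEmbedding_apply, Finset.mem_Ico]
      refine ⟨hab', ?_⟩
      by_contra hcon
      have hst := (Finset.mem_filter.1 hb'.1).2
      rcases hst with h1 | h1
      · omega
      · apply h1
        have h2 := blk_between n j (a := a.1) (b := b.1 - r) (c := b.1) (by omega) (by omega)
          (by rw [ha'.2, hb'.2])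
        rw [h2, ha'.2, hb'.2]
    have hc := Finset.card_le_card hsub
    rw [Finset.card_map, Nat.card_Ico] at hc
    omega

lemma starters_card (r n j : ℕ) : (starters r n j).card ≤ r * 2 ^ j := by
  have := Finset.card_le_mul_card_image_of_maps_to (s := starters r n j)
    (t := Finset.range (2 ^ j)) (f := fun i : Fin n => blk n j i)
    (fun i _ => Finset.mem_range.2 (blk_lt n j i i.2)) r
    (fun l _ => starters_card_block r n j l)
  simpa using this

lemma starters_card_parent (r n j l : ℕ) :
    ((starters r n (j + 1)).filter fun i : Fin n => blk n j i = l).card ≤ r * 2 := by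
  have := Finset.card_le_mul_card_image_of_maps_to
    (s := (starters r n (j + 1)).filter fun i : Fin n => blk n j i = l)
    (t := {2 * l, 2 * l + 1}) (f := fun i : Fin n => blk n (j + 1) i)
    (fun i hi => by
      have h1 := (Finset.mem_filter.1 hi).2
      have h2 := blk_succ n j i.1
      simp only [Finset.mem_insert, Finset.mem_singleton]
      omega) r
    (fun m _ => by
      refine (Finset.card_le_card ?_).trans (starters_card_block r n (j + 1) m)
      intro i hi
      simp only [Finset.mem_filter] at hi ⊢
      exact ⟨hi.1.1, hi.2⟩)
  refine this.trans ?_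
  gcongr
  exact Finset.card_le_two

/-! ## Piecewise polynomial subspaces -/

lemma pad_apply {n : ℕ} (θ : Fin n → ℝ) (i : Fin n) : pad θ i.1 = θ i := by
  simp [pad]

lemma pad_apply_lt {n : ℕ} (θ : Fin n → ℝ) (i : ℕ) (h : i < n) : pad θ i = θ ⟨i, h⟩ := by
  simp [pad, h]

lemma pad_add {n : ℕ} (f g : Fin n → ℝ) : pad (f + g) = fun i => pad f i + pad g i := by
  funext i; by_cases h : i < n <;> simp [pad, h]

lemma pad_smul {n : ℕ} (c : ℝ) (f : Fin n → ℝ) : pad (c • f) = fun i => c * pad f i := by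
  funext i; by_cases h : i < n <;> simp [pad, h]

lemma pad_zero {n : ℕ} : pad (0 : Fin n → ℝ) = fun _ => 0 := by
  funext i; by_cases h : i < n <;> simp [pad, h]

/-- Vectors which are polynomial of degree `< r` on every level-`j` block. -/
def USub (r n j : ℕ) : Submodule ℝ (EuclideanSpace ℝ (Fin n)) where
  carrier := {f | ∀ s, s + r < n → blk n j s = blk n j (s + r) → dseq^[r] (pad f.ofLp) s = 0}
  add_mem' := by
    intro f g hf hg s h1 h2
    rw [WithLp.ofLp_add, pad_add, dseq_iter_add, hf s h1 h2, hg s h1 h2, add_zero]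
  zero_mem' := by
    intro s h1 h2
    rw [WithLp.ofLp_zero, pad_zero, dseq_iter_zero]
  smul_mem' := by
    intro c f hf s h1 h2
    rw [WithLp.ofLp_smul, pad_smul, dseq_iter_smul, hf s h1 h2, mul_zero]

lemma mem_USub {r n j : ℕ} {f : EuclideanSpace ℝ (Fin n)} : f ∈ USub r n j ↔
    ∀ s, s + r < n → blk n j s = blk n j (s + r) → dseq^[r] (pad f.ofLp) s = 0 := Iff.rfl

lemma USub_le_succ (r n j : ℕ) : USub r n j ≤ USub r n (j + 1) := by
  intro f hf s h1 h2
  refine hf s h1 ?_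
  rw [← blk_succ, ← blk_succ n j (s + r), h2]

lemma USub_eq_top (r n j : ℕ) (hr : 1 ≤ r) (hj : n ≤ 2 ^ j) : USub r n j = ⊤ := by
  rw [eq_top_iff]
  intro f _ s h1 h2
  exfalso
  have := blk_width n j (by omega) (by omega) h2
  have h3 : s + r - s = r := by omega
  rw [h3] at this
  nlinarith

/-- Restriction to the block `l` of level `j`. -/
def Mres (n j l : ℕ) (f : EuclideanSpace ℝ (Fin n)) : EuclideanSpace ℝ (Fin n) :=
  WithLp.toLp 2 (fun i => if blk n j i = l then f i else 0)

lemma Mres_apply (n j l : ℕ) (f : EuclideanSpace ℝ (Fin n)) (i : Fin n) :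
    Mres n j l f i = if blk n j i = l then f i else 0 := rfl

lemma euc_inner {n : ℕ} (x y : EuclideanSpace ℝ (Fin n)) : inner ℝ x y = ∑ i, x i * y i := by
  rw [PiLp.inner_apply]
  exact Finset.sum_congr rfl fun i _ => by simp [mul_comm]

lemma Mres_inner (n j l : ℕ) (f g : EuclideanSpace ℝ (Fin n)) :
    inner ℝ (Mres n j l f) g = inner ℝ f (Mres n j l g) := by
  rw [euc_inner, euc_inner]
  refine Finset.sum_congr rfl fun i _ => ?_
  rw [Mres_apply, Mres_apply]; split_ifs <;> simp

lemma Mres_sum (n j : ℕ) (f : EuclideanSpace ℝ (Fin n)) :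
    ∑ l ∈ Finset.range (2 ^ j), Mres n j l f = f := by
  ext i
  rw [WithLp.ofLp_sum, Finset.sum_apply]
  simp only [Mres_apply]
  rw [Finset.sum_ite_eq, if_pos (Finset.mem_range.2 (blk_lt n j i i.2))]

/-- A subset of indices that is a union of level-`j` blocks preserves `USub`. -/
lemma Mres_mem_of (r n j j' l : ℕ) (hblk : ∀ s s', blk n j s = blk n j s' → blk n j' s = blk n j' s')
    {f : EuclideanSpace ℝ (Fin n)}
    (hf : f ∈ USub r n j) : Mres n j' l f ∈ USub r n j := by
  intro s h1 h2
  have hb : ∀ k ≤ r, blk n j' (s + k) = blk n j' s := fun k hk =>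
    hblk _ _ (blk_between n j (by omega) (by omega) h2)
  by_cases hl : blk n j' s = l
  · rw [← hf s h1 h2]
    apply dseq_iter_congr
    intro k hk
    rw [pad_apply_lt _ _ (by omega), pad_apply_lt _ _ (by omega)]
    rw [Mres_apply, if_pos (by rw [← hl]; exact hb k hk)]
  · rw [← dseq_iter_zero r s]
    apply dseq_iter_congr
    intro k hk
    rw [pad_apply_lt _ _ (by omega)]
    rw [Mres_apply, if_neg (by rw [hb k hk]; exact hl)]

lemma USub_eq_zero (r n j : ℕ) {f : EuclideanSpace ℝ (Fin n)} (hf : f ∈ USub r n j)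
    (h0 : ∀ i ∈ starters r n j, f i = 0) : f = 0 := by
  have key : ∀ i, ∀ h : i < n, f ⟨i, h⟩ = 0 := by
    intro i
    induction i using Nat.strong_induction_on with
    | _ i ih =>
      intro h
      by_cases hs : (⟨i, h⟩ : Fin n) ∈ starters r n j
      · exact h0 _ hs
      · simp only [starters, Finset.mem_filter, Finset.mem_univ, true_and, not_or, not_lt,
          not_not] at hs
        obtain ⟨h1, h2⟩ := hs
        have h3 : i - r + r = i := by omega
        have h4 := hf (i - r) (by omega) (by rw [h3]; exact h2)
        rw [dseq_iter_last r _ _ (fun k hk => by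
          rw [pad_apply_lt _ _ (by omega)]; exact ih _ (by omega) _), h3,
          pad_apply_lt _ _ h] at h4
        exact h4
  ext i
  exact key i.1 i.2

lemma finrank_le_of_vanish {n : ℕ} (W : Submodule ℝ (EuclideanSpace ℝ (Fin n)))
    (S : Finset (Fin n)) (h : ∀ f ∈ W, (∀ i ∈ S, f i = 0) → f = 0) :
    Module.finrank ℝ W ≤ S.card := by
  let φ : W →ₗ[ℝ] (S → ℝ) :=
    { toFun := fun f i => (f : EuclideanSpace ℝ (Fin n)) i
      map_add' := fun f g => by funext i; simp
      map_smul' := fun c f => by funext i; simp }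
  have hinj : Function.Injective φ := by
    rw [injective_iff_map_eq_zero]
    intro f hf
    apply Subtype.ext
    apply h f.1 f.2
    intro i hi
    exact congrFun hf ⟨i, hi⟩
  have := LinearMap.finrank_le_finrank_of_injective hinj
  simpa using this

/-- The detail space of block `l` at level `j`. -/
def WSub (r n j l : ℕ) : Submodule ℝ (EuclideanSpace ℝ (Fin n)) where
  carrier := {f | f ∈ USub r n (j + 1) ∧ f ∈ (USub r n j)ᗮ ∧ Mres n j l f = f}
  add_mem' := by
    rintro f g ⟨a1, a2, a3⟩ ⟨b1, b2, b3⟩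
    refine ⟨add_mem a1 b1, add_mem a2 b2, ?_⟩
    conv_rhs => rw [← a3, ← b3]
    ext i
    simp only [Mres_apply, PiLp.add_apply]; split_ifs <;> simp
  zero_mem' := ⟨zero_mem _, zero_mem _, by ext i; simp [Mres_apply]⟩
  smul_mem' := by
    rintro c f ⟨a1, a2, a3⟩
    refine ⟨Submodule.smul_mem _ _ a1, Submodule.smul_mem _ _ a2, ?_⟩
    conv_rhs => rw [← a3]
    ext i
    simp only [Mres_apply, PiLp.smul_apply]; split_ifs <;> simp

lemma finrank_WSub (r n j l : ℕ) : Module.finrank ℝ (WSub r n j l) ≤ r * 2 := by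
  refine (finrank_le_of_vanish _ ((starters r n (j + 1)).filter fun i : Fin n => blk n j i = l)
    ?_).trans (starters_card_parent r n j l)
  rintro f ⟨a1, -, a3⟩ h
  apply USub_eq_zero r n (j + 1) a1
  intro i hi
  by_cases hl : blk n j i = l
  · exact h i (Finset.mem_filter.2 ⟨hi, hl⟩)
  · rw [← a3, Mres_apply, if_neg hl]

lemma finrank_USub (r n j : ℕ) : Module.finrank ℝ (USub r n j) ≤ r * 2 ^ j :=
  (finrank_le_of_vanish _ (starters r n j) (fun _ hf h => USub_eq_zero r n j hf h)).trans
    (starters_card r n j)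

/-- Variation of `D^r θ` inside a block. -/
def Vblk (r n j l : ℕ) (θ : EuclideanSpace ℝ (Fin n)) : ℝ :=
  ∑ u ∈ (Finset.range (n - r)).filter (fun u => blk n j u = l), |DD r θ.ofLp u|

lemma Vblk_nonneg (r n j l : ℕ) (θ : EuclideanSpace ℝ (Fin n)) : 0 ≤ Vblk r n j l θ :=
  Finset.sum_nonneg fun _ _ => abs_nonneg _

lemma Vblk_sum (r n j : ℕ) (θ : EuclideanSpace ℝ (Fin n)) :
    ∑ l ∈ Finset.range (2 ^ j), Vblk r n j l θ = Dl1 r θ.ofLp := by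
  unfold Vblk Dl1
  exact Finset.sum_fiberwise_of_maps_to (fun u hu => Finset.mem_range.2
    (blk_lt n j u (by have := Finset.mem_range.1 hu; omega))) _

/-- Approximation of `θ` on a block by an element of `USub`. -/
lemma block_approx (r n j l : ℕ) (hr : 1 ≤ r) (θ : EuclideanSpace ℝ (Fin n)) :
    ∃ p ∈ USub r n j, ∀ i : Fin n, blk n j i = l →
      |θ i - p i| ≤ ((n : ℝ) / 2 ^ j) ^ (r - 1) * Vblk r n j l θ := by
  set S := Finset.univ.filter fun i : Fin n => blk n j i = l with hS
  rcases S.eq_empty_or_nonempty with h | h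
  · refine ⟨0, zero_mem _, fun i hi => ?_⟩
    have : i ∈ S := Finset.mem_filter.2 ⟨Finset.mem_univ _, hi⟩
    rw [h] at this; simp at this
  have ha := S.min'_mem h
  have hmin : ∀ i : Fin n, blk n j i = l → (S.min' h).1 ≤ i.1 := fun i hi =>
    S.min'_le i (Finset.mem_filter.2 ⟨Finset.mem_univ _, hi⟩)
  set a := S.min' h
  have hal : blk n j a.1 = l := (Finset.mem_filter.1 ha).2
  obtain ⟨q, rfl⟩ : ∃ q, r = q + 1 := ⟨r - 1, by omega⟩
  obtain ⟨p, hp, hb⟩ := taylor_exists q (fun s => pad θ.ofLp (s + a.1))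
  let P : EuclideanSpace ℝ (Fin n) := WithLp.toLp 2 (fun i => p (i.1 - a.1))
  refine ⟨Mres n j l P, ?_, ?_⟩
  · intro s h1 h2
    have hbk : ∀ k ≤ q + 1, blk n j (s + k) = blk n j s := fun k hk =>
      blk_between n j (by omega) (by omega) h2
    by_cases hl : blk n j s = l
    · have has : a.1 ≤ s := hmin ⟨s, by omega⟩ hl
      rw [← hp (s - a.1)]
      obtain ⟨v, rfl⟩ : ∃ v, s = v + a.1 := ⟨s - a.1, by omega⟩
      rw [Nat.add_sub_cancel, ← dseq_iter_shift]
      apply dseq_iter_congr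
      intro k hk
      have h3 : blk n j (v + k + a.1) = l := by
        rw [show v + k + a.1 = v + a.1 + k by ring, hbk k hk, hl]
      rw [pad_apply_lt _ _ (by omega), Mres_apply, if_pos h3]
      simp [P]
    · rw [← dseq_iter_zero (q + 1) s]
      apply dseq_iter_congr
      intro k hk
      rw [pad_apply_lt _ _ (by omega), Mres_apply, if_neg]
      rw [hbk k hk]; exact hl
  · intro i hi
    have hai := hmin i hi
    rw [Mres_apply, if_pos hi]
    have h1 := hb (i.1 - a.1)
    have h2 : i.1 - a.1 + a.1 = i.1 := by omega
    simp only [h2] at h1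
    rw [pad_apply] at h1
    refine h1.trans ?_
    rw [Nat.add_sub_cancel]
    have hw := blk_width n j (by omega) hai (by rw [hal, hi])
    gcongr
    · rw [le_div_iff₀ (by positivity)]
      have h := (Nat.cast_le (α := ℝ)).2 hw.le
      rw [Nat.cast_mul, Nat.cast_pow, Nat.cast_ofNat] at h
      exact h
    · unfold Vblk DD
      simp only [dseq_iter_shift]
      rw [← Finset.sum_image (s := Finset.range (i.1 - a.1 - q)) (g := fun u => u + a.1)
        (f := fun u => |dseq^[q + 1] (pad θ.ofLp) u|) (by
          intro x _ y _ hxy; simpa using hxy)]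
      apply Finset.sum_le_sum_of_subset_of_nonneg
      · intro u hu
        obtain ⟨v, hv, rfl⟩ := Finset.mem_image.1 hu
        have hv := Finset.mem_range.1 hv
        refine Finset.mem_filter.2 ⟨Finset.mem_range.2 (by omega), ?_⟩
        rw [blk_between n j (a := a.1) (c := i.1) (by omega) (by omega) (by rw [hal, hi]), hal]
      · intro _ _ _; exact abs_nonneg _

/-- Coefficient bound for a unit vector of the detail space. -/
lemma coef_bound (r n j l : ℕ) (hr : 1 ≤ r) (θ e : EuclideanSpace ℝ (Fin n))
    (he : e ∈ WSub r n j l) (hne : ‖e‖ = 1) :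
    |inner ℝ e θ| ≤ √(2 * n / 2 ^ j) * ((n : ℝ) / 2 ^ j) ^ (r - 1) * Vblk r n j l θ := by
  have hV := Vblk_nonneg r n j l θ
  obtain ⟨he1, he2, he3⟩ := he
  rcases le_total n (2 ^ j) with hj | hj
  · rw [USub_eq_top r n j hr hj] at he2
    simp at he2
    rw [he2] at hne; simp at hne
  obtain ⟨p, hp, hb⟩ := block_approx r n j l hr θ
  set B := ((n : ℝ) / 2 ^ j) ^ (r - 1) * Vblk r n j l θ with hB
  have hB0 : 0 ≤ B := by positivity
  have h1 : inner ℝ e θ = inner ℝ e (Mres n j l (θ - p)) := by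
    rw [← Mres_inner, he3, inner_sub_right, Submodule.inner_left_of_mem_orthogonal hp he2, sub_zero]
  rw [h1]
  refine (abs_real_inner_le_norm _ _).trans ?_
  rw [hne, one_mul, EuclideanSpace.norm_eq, mul_assoc, ← hB]
  have h2 : ∑ i, ‖Mres n j l (θ - p) i‖ ^ 2 ≤ (2 * n / 2 ^ j) * B ^ 2 := by
    calc ∑ i, ‖Mres n j l (θ - p) i‖ ^ 2
        ≤ ∑ i : Fin n, if blk n j i = l then B ^ 2 else 0 := by
          apply Finset.sum_le_sum
          intro i _
          rw [Mres_apply]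
          split_ifs with hi
          · have := hb i hi
            rw [Real.norm_eq_abs, PiLp.sub_apply]
            gcongr
          · simp
      _ = ((Finset.univ.filter fun i : Fin n => blk n j i = l).card : ℝ) * B ^ 2 := by
          rw [← Finset.sum_filter, Finset.sum_const, nsmul_eq_mul]
      _ ≤ _ := by
          gcongr
          exact blk_card n j l hj
  refine (Real.sqrt_le_sqrt h2).trans ?_
  rw [Real.sqrt_mul (by positivity), Real.sqrt_sq hB0]

/-! ## Orthonormal families at each level -/

lemma basis_expand {n : ℕ} (W : Submodule ℝ (EuclideanSpace ℝ (Fin n)))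
    (ξ x : EuclideanSpace ℝ (Fin n)) (hx : x ∈ W) :
    inner ℝ ξ x = ∑ k, inner ℝ (stdOrthonormalBasis ℝ W k : EuclideanSpace ℝ (Fin n)) ξ *
      inner ℝ (stdOrthonormalBasis ℝ W k : EuclideanSpace ℝ (Fin n)) x := by
  have h := (stdOrthonormalBasis ℝ W).sum_repr' ⟨x, hx⟩
  have h2 := congrArg (Subtype.val) h
  simp only [Submodule.coe_sum, Submodule.coe_smul, Submodule.coe_inner] at h2
  conv_lhs => rw [← h2]
  rw [inner_sum]
  refine Finset.sum_congr rfl fun k _ => ?_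
  rw [inner_smul_right, real_inner_comm _ ξ]
  ring

lemma basis_norm {n : ℕ} (W : Submodule ℝ (EuclideanSpace ℝ (Fin n)))
    (x : EuclideanSpace ℝ (Fin n)) (hx : x ∈ W) :
    ∑ k, (inner ℝ (stdOrthonormalBasis ℝ W k : EuclideanSpace ℝ (Fin n)) x) ^ 2 = ‖x‖ ^ 2 := by
  rw [← real_inner_self_eq_norm_sq, basis_expand W x x hx]
  exact Finset.sum_congr rfl fun k _ => by ring

lemma basis_unit {n : ℕ} (W : Submodule ℝ (EuclideanSpace ℝ (Fin n))) (k) :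
    ‖(stdOrthonormalBasis ℝ W k : EuclideanSpace ℝ (Fin n))‖ = 1 :=
  (stdOrthonormalBasis ℝ W).orthonormal.1 k

/-- Orthogonal projection on `USub`. -/
def QP (r n j : ℕ) (θ : EuclideanSpace ℝ (Fin n)) : EuclideanSpace ℝ (Fin n) :=
  (USub r n j).starProjection θ

lemma QP_mem (r n j : ℕ) (θ : EuclideanSpace ℝ (Fin n)) : QP r n j θ ∈ USub r n j :=
  Submodule.starProjection_apply_mem _ _

lemma QP_inner (r n j : ℕ) (θ u : EuclideanSpace ℝ (Fin n)) (hu : u ∈ USub r n j) :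
    inner ℝ u (QP r n j θ) = inner ℝ u θ := by
  have h := Submodule.sub_starProjection_mem_orthogonal (K := USub r n j) θ
  have := Submodule.inner_right_of_mem_orthogonal hu h
  rw [inner_sub_right] at this
  unfold QP
  linarith

lemma norm_le_of_inner_eq {n : ℕ} (w θ : EuclideanSpace ℝ (Fin n))
    (h : inner ℝ w w = inner ℝ w θ) : ‖w‖ ≤ ‖θ‖ := by
  have h1 := real_inner_le_norm w θ
  rw [← h, real_inner_self_eq_norm_sq] at h1
  by_contra hc
  push Not at hc
  have := norm_nonneg θ
  nlinarith

lemma base_level (r n j : ℕ) : ∃ (m : ℕ) (e : Fin m → EuclideanSpace ℝ (Fin n)),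
    m ≤ r * 2 ^ j ∧ (∀ k, ‖e k‖ = 1) ∧ ∀ θ : EuclideanSpace ℝ (Fin n),
      (∀ ξ, inner ℝ ξ (QP r n j θ) = ∑ k, inner ℝ (e k) ξ * inner ℝ (e k) θ) ∧
      ∑ k, (inner ℝ (e k) θ) ^ 2 ≤ ‖θ‖ ^ 2 := by
  refine ⟨_, fun k => stdOrthonormalBasis ℝ (USub r n j) k, finrank_USub r n j,
    fun k => basis_unit _ k, fun θ => ?_⟩
  have h : ∀ k, inner ℝ (stdOrthonormalBasis ℝ (USub r n j) k : EuclideanSpace ℝ (Fin n)) θ =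
      inner ℝ (stdOrthonormalBasis ℝ (USub r n j) k : EuclideanSpace ℝ (Fin n)) (QP r n j θ) :=
    fun k => (QP_inner r n j θ _ (Subtype.mem _)).symm
  simp only [h]
  refine ⟨fun ξ => basis_expand _ ξ _ (QP_mem r n j θ), ?_⟩
  rw [basis_norm _ _ (QP_mem r n j θ)]
  have := norm_le_of_inner_eq (QP r n j θ) θ (QP_inner r n j θ _ (QP_mem r n j θ))
  gcongr

lemma detail_level (r n j : ℕ) (hr : 1 ≤ r) :
    ∃ (K : Type) (_ : Fintype K) (e : K → EuclideanSpace ℝ (Fin n)),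
    Fintype.card K ≤ r * 2 * 2 ^ j ∧ (∀ k, ‖e k‖ = 1) ∧ ∀ θ : EuclideanSpace ℝ (Fin n),
      (∀ ξ, inner ℝ ξ (QP r n (j + 1) θ - QP r n j θ) =
        ∑ k, inner ℝ (e k) ξ * inner ℝ (e k) θ) ∧
      ∑ k, (inner ℝ (e k) θ) ^ 2 ≤ ‖θ‖ ^ 2 ∧
      ∑ k, |inner ℝ (e k) θ| ≤
        r * 2 * (√(2 * n / 2 ^ j) * ((n : ℝ) / 2 ^ j) ^ (r - 1) * Dl1 r θ.ofLp) := by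
  let e : (Σ l : Fin (2 ^ j), Fin (Module.finrank ℝ (WSub r n j l))) →
    EuclideanSpace ℝ (Fin n) := fun k => stdOrthonormalBasis ℝ (WSub r n j k.1) k.2
  refine ⟨Σ l : Fin (2 ^ j), Fin (Module.finrank ℝ (WSub r n j l)), inferInstance, e, ?_,
    fun k => basis_unit _ _, fun θ => ?_⟩
  · rw [Fintype.card_sigma]
    simp only [Fintype.card_fin]
    calc ∑ l : Fin (2 ^ j), Module.finrank ℝ (WSub r n j l) ≤ ∑ l : Fin (2 ^ j), r * 2 :=
          Finset.sum_le_sum fun l _ => finrank_WSub r n j l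
      _ = r * 2 * 2 ^ j := by simp [mul_comm]
  set w := QP r n (j + 1) θ - QP r n j θ with hw
  have hwU : w ∈ USub r n (j + 1) :=
    sub_mem (QP_mem _ _ _ _) (USub_le_succ r n j (QP_mem _ _ _ _))
  have hwO : w ∈ (USub r n j)ᗮ := by
    rw [Submodule.mem_orthogonal]
    intro u hu
    rw [hw, inner_sub_right, QP_inner _ _ _ _ _ hu, QP_inner _ _ _ _ _ (USub_le_succ r n j hu),
      sub_self]
  have hMid : ∀ l f, Mres n j l (Mres n j l f) = Mres n j l f := by
    intro l f; ext i; simp only [Mres_apply]; split_ifs <;> rfl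
  have hMw : ∀ l, Mres n j l w ∈ WSub r n j l := by
    intro l
    refine ⟨?_, ?_, hMid l w⟩
    · apply Mres_mem_of _ _ _ _ _ _ hwU
      intro s s' h
      rw [← blk_succ, ← blk_succ n j s', h]
    · rw [Submodule.mem_orthogonal]
      intro u hu
      rw [← Mres_inner]
      exact Submodule.inner_right_of_mem_orthogonal
        (Mres_mem_of r n j j l (fun _ _ h => h) hu) hwO
  have hcoef : ∀ l, ∀ f ∈ WSub r n j l, inner ℝ f (Mres n j l w) = inner ℝ f θ := by
    rintro l f ⟨h1, h2, h3⟩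
    rw [← Mres_inner, h3, hw, inner_sub_right, QP_inner _ _ _ _ _ h1,
      Submodule.inner_left_of_mem_orthogonal (QP_mem _ _ _ _) h2, sub_zero]
  have hcoef' : ∀ (l : ℕ) (k : Fin (Module.finrank ℝ (WSub r n j l))),
      inner ℝ (stdOrthonormalBasis ℝ (WSub r n j l) k : EuclideanSpace ℝ (Fin n)) θ =
      inner ℝ (stdOrthonormalBasis ℝ (WSub r n j l) k : EuclideanSpace ℝ (Fin n))
        (Mres n j l w) := fun l k => (hcoef l _ (Subtype.mem _)).symm
  have hMsum : ∀ ξ, inner ℝ ξ w = ∑ l : Fin (2 ^ j), inner ℝ ξ (Mres n j l w) := by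
    intro ξ
    conv_lhs => rw [← Mres_sum n j w]
    rw [inner_sum, Finset.sum_range]
  refine ⟨fun ξ => ?_, ?_, ?_⟩
  · rw [Fintype.sum_sigma, hMsum]
    refine Finset.sum_congr rfl fun l _ => ?_
    simp only [e, hcoef']
    exact basis_expand _ ξ _ (hMw l)
  · rw [Fintype.sum_sigma]
    simp only [e, hcoef']
    have h1 : ∀ l : Fin (2 ^ j), ∑ k, (inner ℝ (stdOrthonormalBasis ℝ (WSub r n j l) k :
        EuclideanSpace ℝ (Fin n)) (Mres n j l w)) ^ 2 = inner ℝ w (Mres n j l w) := by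
      intro l
      rw [basis_norm _ _ (hMw l), ← real_inner_self_eq_norm_sq, Mres_inner, hMid]
    simp only [h1]
    rw [← hMsum w, real_inner_self_eq_norm_sq]
    have : ‖w‖ ≤ ‖θ‖ := by
      apply norm_le_of_inner_eq
      conv_lhs => rw [hw]
      rw [inner_sub_right, QP_inner _ _ _ _ _ hwU,
        Submodule.inner_left_of_mem_orthogonal (QP_mem _ _ _ _) hwO, sub_zero]
    gcongr
  · rw [Fintype.sum_sigma]
    set G := √(2 * n / 2 ^ j) * ((n : ℝ) / 2 ^ j) ^ (r - 1) with hG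
    have hG0 : 0 ≤ G := by positivity
    calc ∑ l : Fin (2 ^ j), ∑ k, |inner ℝ (e ⟨l, k⟩) θ|
        ≤ ∑ l : Fin (2 ^ j), (r * 2 : ℝ) * (G * Vblk r n j l θ) := by
          refine Finset.sum_le_sum fun l _ => ?_
          have hV := Vblk_nonneg r n j l θ
          calc ∑ k, |inner ℝ (e ⟨l, k⟩) θ|
              ≤ ∑ k : Fin (Module.finrank ℝ (WSub r n j l)), G * Vblk r n j l θ :=
                Finset.sum_le_sum fun k _ => coef_bound r n j l hr θ _ (Subtype.mem _)
                  (basis_unit _ _)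
            _ = (Module.finrank ℝ (WSub r n j l) : ℝ) * (G * Vblk r n j l θ) := by simp
            _ ≤ _ := by
                gcongr
                exact_mod_cast finrank_WSub r n j l
      _ = _ := by
          rw [← Finset.mul_sum, ← Finset.mul_sum,
            ← Finset.sum_range (f := fun l => Vblk r n j l θ), Vblk_sum]

/-! ## Gaussian estimates -/

instance gaussVec_prob (n : ℕ) (σ : ℝ) : IsProbabilityMeasure (gaussVec n σ) := by
  unfold gaussVec; infer_instance

lemma gauss_mgf (n : ℕ) (σ : ℝ) (e : EuclideanSpace ℝ (Fin n)) (he : ‖e‖ = 1) (c : ℝ) :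
    Integrable (fun ξ : Fin n → ℝ => Real.exp (c * inner ℝ e (WithLp.toLp 2 ξ))) (gaussVec n σ) ∧
    ∫ ξ, Real.exp (c * inner ℝ e (WithLp.toLp 2 ξ)) ∂gaussVec n σ =
      Real.exp (σ ^ 2 * c ^ 2 / 2) := by
  have h1 : (fun ξ : Fin n → ℝ => Real.exp (c * inner ℝ e (WithLp.toLp 2 ξ))) =
      fun ξ => ∏ i, Real.exp ((c * e i) * ξ i) := by
    funext ξ
    rw [← Real.exp_sum, euc_inner, Finset.mul_sum]
    congr 1
    exact Finset.sum_congr rfl fun i _ => by ring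
  rw [h1]
  unfold gaussVec
  constructor
  · exact Integrable.fintype_prod (fun i => integrable_exp_mul_gaussianReal (c * e i))
  · rw [integral_fintype_prod_eq_prod (fun i x => Real.exp ((c * e i) * x))]
    have h2 : ∀ i, ∫ x, Real.exp ((c * e i) * x) ∂gaussianReal 0 (σ ^ 2).toNNReal =
        Real.exp (σ ^ 2 * (c * e i) ^ 2 / 2) := by
      intro i
      have := congrFun (mgf_id_gaussianReal (μ := 0) (v := (σ ^ 2).toNNReal)) (c * e i)
      rw [mgf] at this
      simp only [id] at this
      rw [this, Real.coe_toNNReal _ (sq_nonneg σ)]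
      simp
    simp only [h2]
    rw [← Real.exp_sum]
    congr 1
    have h3 : ∑ i, e i ^ 2 = 1 := by
      have := EuclideanSpace.real_norm_sq_eq e
      rw [he] at this
      simpa using this.symm
    calc ∑ i, σ ^ 2 * (c * e i) ^ 2 / 2 = σ ^ 2 * c ^ 2 / 2 * ∑ i, e i ^ 2 := by
          rw [Finset.mul_sum]; exact Finset.sum_congr rfl fun i _ => by ring
      _ = _ := by rw [h3, mul_one]

/-- Exponential majorant of `(|x| - τ)_+ ^ 2`. -/
def Hmaj (σ τ x : ℝ) : ℝ :=
  σ ^ 2 / 2 * Real.exp (-(2 * τ / σ)) * (Real.exp (2 / σ * x) + Real.exp (-(2 / σ) * x))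

lemma Hmaj_nonneg (σ τ x : ℝ) : 0 ≤ Hmaj σ τ x := by unfold Hmaj; positivity

lemma sq_le_Hmaj (σ τ x : ℝ) (hσ : 0 < σ) (h : τ ≤ |x|) : (|x| - τ) ^ 2 ≤ Hmaj σ τ x := by
  set z := 2 / σ * (|x| - τ) with hz
  have hz0 : 0 ≤ z := mul_nonneg (by positivity) (by linarith)
  have h1 : (|x| - τ) ^ 2 = σ ^ 2 / 4 * z ^ 2 := by rw [hz]; field_simp; ring
  have h2 := Real.quadratic_le_exp_of_nonneg hz0
  have h3 : Real.exp z = Real.exp (-(2 * τ / σ)) * Real.exp (2 / σ * |x|) := by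
    rw [← Real.exp_add, hz]; congr 1; field_simp; ring
  have h4 : Real.exp (2 / σ * |x|) ≤ Real.exp (2 / σ * x) + Real.exp (-(2 / σ) * x) := by
    rcases abs_choice x with h | h <;> rw [h]
    · linarith [Real.exp_pos (-(2 / σ) * x)]
    · rw [mul_neg, ← neg_mul]; linarith [Real.exp_pos (2 / σ * x)]
  calc (|x| - τ) ^ 2 = σ ^ 2 / 2 * (z ^ 2 / 2) := by rw [h1]; ring
    _ ≤ σ ^ 2 / 2 * Real.exp z := by gcongr; linarith
    _ ≤ Hmaj σ τ x := by
      rw [h3, Hmaj, mul_assoc]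
      gcongr

lemma Hmaj_integral (n : ℕ) (σ τ : ℝ) (hσ : 0 < σ) (e : EuclideanSpace ℝ (Fin n))
    (he : ‖e‖ = 1) :
    Integrable (fun ξ : Fin n → ℝ => Hmaj σ τ (inner ℝ e (WithLp.toLp 2 ξ))) (gaussVec n σ) ∧
    ∫ ξ, Hmaj σ τ (inner ℝ e (WithLp.toLp 2 ξ)) ∂gaussVec n σ =
      σ ^ 2 * (Real.exp 2 * Real.exp (-(2 * τ / σ))) := by
  obtain ⟨i1, v1⟩ := gauss_mgf n σ e he (2 / σ)
  obtain ⟨i2, v2⟩ := gauss_mgf n σ e he (-(2 / σ))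
  unfold Hmaj
  refine ⟨(i1.add i2).const_mul _, ?_⟩
  rw [integral_const_mul, integral_add i1 i2, v1, v2]
  have h1 : σ ^ 2 * (2 / σ) ^ 2 / 2 = 2 := by field_simp
  have h2 : σ ^ 2 * (-(2 / σ)) ^ 2 / 2 = 2 := by rw [neg_sq]; exact h1
  rw [h1, h2]; ring

lemma level_term (σ τ t B c x : ℝ) (hσ : 0 < σ) (ht : 0 < t) (hB : 0 < B) :
    x * c ≤ τ * |c| + t / (2 * B) * Hmaj σ τ x + B / (2 * t) * c ^ 2 := by
  have h0 := Hmaj_nonneg σ τ x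
  have h1 : x * c ≤ |x| * |c| := by rw [← abs_mul]; exact le_abs_self _
  rcases le_total τ |x| with h | h
  · have h2 := sq_le_Hmaj σ τ x hσ h
    have h3 : (|x| - τ) * |c| ≤ t / (2 * B) * (|x| - τ) ^ 2 + B / (2 * t) * |c| ^ 2 := by
      have : t / (2 * B) * (|x| - τ) ^ 2 + B / (2 * t) * |c| ^ 2 - (|x| - τ) * |c| =
          (t * (|x| - τ) - B * |c|) ^ 2 / (2 * B * t) := by field_simp; ring
      have h5 : 0 ≤ (t * (|x| - τ) - B * |c|) ^ 2 / (2 * B * t) := by positivity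
      linarith
    have h4 : t / (2 * B) * (|x| - τ) ^ 2 ≤ t / (2 * B) * Hmaj σ τ x := by gcongr
    rw [sq_abs] at h3
    nlinarith
  · have h2 : |x| * |c| ≤ τ * |c| := by gcongr
    have h3 : 0 ≤ t / (2 * B) * Hmaj σ τ x := by positivity
    have h4 : 0 ≤ B / (2 * t) * c ^ 2 := by positivity
    linarith

lemma level_Z {K : Type} [Fintype K] (n : ℕ) (σ τ t B D : ℝ) (M : ℝ)
    (e : K → EuclideanSpace ℝ (Fin n)) (he : ∀ k, ‖e k‖ = 1) (hM : (Fintype.card K : ℝ) ≤ M)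
    (hσ : 0 < σ) (ht : 0 < t) (hB : 0 < B) :
    ∃ Z : (Fin n → ℝ) → ℝ, Integrable Z (gaussVec n σ) ∧
      ∫ ξ, Z ξ ∂gaussVec n σ ≤
        D + t / (2 * B) * (M * (σ ^ 2 * (Real.exp 2 * Real.exp (-(2 * τ / σ))))) + B * t / 2 ∧
      ∀ (ξ : Fin n → ℝ) (θ : EuclideanSpace ℝ (Fin n)),
        ∑ k, (inner ℝ (e k) θ) ^ 2 ≤ t ^ 2 → τ * ∑ k, |inner ℝ (e k) θ| ≤ D →
        ∑ k, inner ℝ (e k) (WithLp.toLp 2 ξ) * inner ℝ (e k) θ ≤ Z ξ := by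
  have hI : Integrable (fun ξ : Fin n → ℝ =>
      ∑ k, Hmaj σ τ (inner ℝ (e k) (WithLp.toLp 2 ξ))) (gaussVec n σ) :=
    integrable_finsetSum _ fun k _ => (Hmaj_integral n σ τ hσ (e k) (he k)).1
  refine ⟨fun ξ => (D + B * t / 2) +
    t / (2 * B) * (∑ k, Hmaj σ τ (inner ℝ (e k) (WithLp.toLp 2 ξ))), ?_, ?_, ?_⟩
  · exact (integrable_const _).add (hI.const_mul _)
  · have h1 := integral_add (integrable_const (μ := gaussVec n σ) (D + B * t / 2))
      (hI.const_mul (t / (2 * B)))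
    rw [h1, integral_const_mul,
      integral_finsetSum _ fun k _ => (Hmaj_integral n σ τ hσ (e k) (he k)).1]
    simp only [(Hmaj_integral n σ τ hσ (e _) (he _)).2, integral_const, probReal_univ, one_smul,
      Finset.sum_const, Finset.card_univ, nsmul_eq_mul]
    have h2 : t / (2 * B) * (Fintype.card K *
        (σ ^ 2 * (Real.exp 2 * Real.exp (-(2 * τ / σ))))) ≤
        t / (2 * B) * (M * (σ ^ 2 * (Real.exp 2 * Real.exp (-(2 * τ / σ))))) := by
      gcongr
    linarith
  · intro ξ θ h1 h2
    have h3 := Finset.sum_le_sum fun k (_ : k ∈ Finset.univ) =>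
      level_term σ τ t B (inner ℝ (e k) θ) (inner ℝ (e k) (WithLp.toLp 2 ξ)) hσ ht hB
    rw [Finset.sum_add_distrib, Finset.sum_add_distrib, ← Finset.mul_sum, ← Finset.mul_sum,
      ← Finset.mul_sum] at h3
    have h4 : B / (2 * t) * ∑ k, (inner ℝ (e k) θ) ^ 2 ≤ B / (2 * t) * t ^ 2 := by gcongr
    have h5 : B / (2 * t) * t ^ 2 = B * t / 2 := by field_simp
    linarith

/-! ## Assembling the bound -/

lemma scale_bound (r n J i : ℕ) (hr : 1 ≤ r) (hn : 0 < n) (t V d : ℝ)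
    (ht : 0 < t) (hJ : √(n : ℝ) * V ≤ t * 2 ^ (J * r))
    (hd : d ≤ V * (n : ℝ) ^ (1 - (r : ℤ))) :
    √(2 * n / 2 ^ (J + i)) * ((n : ℝ) / 2 ^ (J + i)) ^ (r - 1) * d ≤
      √2 * t * √2 ^ J * (1 / √2) ^ i := by
  obtain ⟨q, rfl⟩ : ∃ q, r = q + 1 := ⟨r - 1, by omega⟩
  have hn' : (0 : ℝ) < n := by exact_mod_cast hn
  set s := √(2 : ℝ) with hs
  have hs2 : s ^ 2 = 2 := Real.sq_sqrt (by norm_num)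
  have hs1 : 1 ≤ s := Real.one_le_sqrt.2 (by norm_num)
  have hs0 : 0 < s := by linarith
  have h2 : √(2 * n / 2 ^ (J + i)) = s * √(n : ℝ) / s ^ (J + i) := by
    rw [Real.sqrt_div (by positivity), Real.sqrt_mul (by norm_num), ← hs, ← hs2, ← pow_mul,
      mul_comm 2 (J + i), pow_mul, Real.sqrt_sq (by positivity)]
  have hz : (n : ℝ) ^ (1 - ((q + 1 : ℕ) : ℤ)) = ((n : ℝ) ^ q)⁻¹ := by
    rw [show (1 - ((q + 1 : ℕ) : ℤ)) = -(q : ℤ) by push_cast; ring, zpow_neg, zpow_natCast]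
  rw [hz] at hd
  rw [h2, Nat.add_sub_cancel]
  have hJ' : √(n : ℝ) * V ≤ t * s ^ (2 * (J * (q + 1))) := by
    rw [pow_mul, hs2]; exact hJ
  have hden : ((2 : ℝ) ^ (J + i)) ^ q = s ^ (2 * (J + i) * q) := by
    rw [← hs2, ← pow_mul, ← pow_mul, mul_assoc]
  calc s * √(n : ℝ) / s ^ (J + i) * ((n : ℝ) / 2 ^ (J + i)) ^ q * d
      ≤ s * √(n : ℝ) / s ^ (J + i) * ((n : ℝ) / 2 ^ (J + i)) ^ q * (V * ((n : ℝ) ^ q)⁻¹) := by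
        gcongr
    _ = s / s ^ (J + i) / s ^ (2 * (J + i) * q) * (√(n : ℝ) * V) := by
        rw [div_pow, hden]; field_simp
    _ ≤ s / s ^ (J + i) / s ^ (2 * (J + i) * q) * (t * s ^ (2 * (J * (q + 1)))) := by
        gcongr
    _ = s * t * s ^ J * (1 / s) ^ i * (1 / s ^ (2 * i * q)) := by
        rw [one_div_pow]
        field_simp
        ring
    _ ≤ s * t * s ^ J * (1 / s) ^ i * 1 := by
        gcongr
        rw [div_le_one (by positivity)]
        exact one_le_pow₀ hs1
    _ = _ := by ring

lemma QP_top (r n j : ℕ) (hr : 1 ≤ r) (hj : n ≤ 2 ^ j) (θ : EuclideanSpace ℝ (Fin n)) :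
    QP r n j θ = θ := by
  have : θ ∈ USub r n j := by rw [USub_eq_top r n j hr hj]; trivial
  exact Submodule.starProjection_eq_self_iff.2 this

lemma exp_pow_bound (i : ℕ) : (2 : ℝ) ^ i * Real.exp (-(2 * i)) ≤ (2 / 3) ^ i * (2 / 3) ^ i := by
  have h1 : Real.exp (-(2 * i)) = (Real.exp (-2)) ^ i := by
    rw [← Real.exp_nat_mul]; congr 1; ring
  rw [h1, ← mul_pow, ← mul_pow]
  have h2 : Real.exp (-2) ≤ 2 / 9 := by
    rw [Real.exp_neg, inv_le_comm₀ (Real.exp_pos _) (by norm_num)]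
    have := Real.quadratic_le_exp_of_nonneg (x := 2) (by norm_num)
    norm_num at this ⊢
    linarith
  exact pow_le_pow_left₀ (by positivity) (by linarith) i

lemma core (r : ℕ) (hr : 1 ≤ r) : ∃ C : ℝ, 0 < C ∧ ∀ n : ℕ, 0 < n → ∀ σ : ℝ, 0 < σ →
    ∀ t : ℝ, 0 < t → ∀ V : ℝ, ∀ J : ℕ, √(n : ℝ) * V ≤ t * 2 ^ (J * r) →
    ∃ Z : (Fin n → ℝ) → ℝ, Integrable Z (gaussVec n σ) ∧
      ∫ ξ, Z ξ ∂gaussVec n σ ≤ C * (σ * t * √2 ^ J) ∧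
      ∀ (ξ : Fin n → ℝ) (θ : EuclideanSpace ℝ (Fin n)), ‖θ‖ ≤ t →
        Dl1 r θ.ofLp ≤ V * (n : ℝ) ^ (1 - (r : ℤ)) → inner ℝ (WithLp.toLp 2 ξ) θ ≤ Z ξ := by
  let g : ℕ → ℝ := fun i => (2 * r * √2) * ((i : ℝ) ^ 1 * (1 / √2) ^ i) +
    (r * Real.exp 2 + 1 / 2) * (2 / 3) ^ i
  have hs2 : (√(2 : ℝ)) ^ 2 = 2 := Real.sq_sqrt (by norm_num)
  have hs1 : 1 < √(2 : ℝ) := Real.lt_sqrt_of_sq_lt (by norm_num)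
  have hg : Summable g := by
    apply Summable.add
    · apply Summable.mul_left
      apply summable_pow_mul_geometric_of_norm_lt_one
      rw [Real.norm_of_nonneg (by positivity), div_lt_one (by positivity)]
      exact hs1
    · apply Summable.mul_left
      exact summable_geometric_of_lt_one (by norm_num) (by norm_num)
  have hg0 : ∀ i, 0 ≤ g i := fun i => by positivity
  refine ⟨(r * Real.exp 2 / 2 + 1 / 2) + ∑' i, g i, ?_, ?_⟩
  · have : 0 ≤ ∑' i, g i := tsum_nonneg hg0
    positivity
  intro n hn σ hσ t ht V J hJ
  set S := √(2 : ℝ) ^ J with hS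
  have hS0 : 0 < S := by positivity
  have hSJ : (2 : ℝ) ^ J = S ^ 2 := by rw [hS, ← pow_mul, mul_comm, pow_mul, hs2]
  -- base level
  obtain ⟨m, e, hm, he, hexp⟩ := base_level r n J
  obtain ⟨Z0, hZ0i, hZ0v, hZ0⟩ := level_Z n σ 0 t (σ * S) 0 (r * 2 ^ J) e he
    (by rw [Fintype.card_fin]; exact_mod_cast hm) hσ ht (by positivity)
  -- detail levels
  have hdet : ∀ i : ℕ, ∃ Z : (Fin n → ℝ) → ℝ, Integrable Z (gaussVec n σ) ∧
      ∫ ξ, Z ξ ∂gaussVec n σ ≤ g i * (σ * t * S) ∧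
      ∀ (ξ : Fin n → ℝ) (θ : EuclideanSpace ℝ (Fin n)), ‖θ‖ ≤ t →
        Dl1 r θ.ofLp ≤ V * (n : ℝ) ^ (1 - (r : ℤ)) →
        inner ℝ (WithLp.toLp 2 ξ) (QP r n (J + i + 1) θ - QP r n (J + i) θ) ≤ Z ξ := by
    intro i
    obtain ⟨K, _, e, hm, he, hexp⟩ := detail_level r n (J + i) hr
    obtain ⟨Z, hZi, hZv, hZ⟩ := level_Z n σ (σ * i) t (σ * S * (2 / 3) ^ i)
      (σ * i * (r * 2 * (√2 * t * S * (1 / √2) ^ i))) (r * 2 * 2 ^ (J + i)) e he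
      (by exact_mod_cast hm) hσ ht (by positivity)
    refine ⟨Z, hZi, hZv.trans ?_, fun ξ θ h1 h2 => ?_⟩
    · have hx : 2 * (σ * i) / σ = 2 * i := by field_simp
      rw [hx]
      have hb := exp_pow_bound i
      have hmid : t / (2 * (σ * S * (2 / 3) ^ i)) *
          (r * 2 * 2 ^ (J + i) * (σ ^ 2 * (Real.exp 2 * Real.exp (-(2 * i))))) ≤
          (r * Real.exp 2) * (2 / 3) ^ i * (σ * t * S) := by
        rw [pow_add, hSJ]
        calc t / (2 * (σ * S * (2 / 3) ^ i)) *
            (r * 2 * (S ^ 2 * 2 ^ i) * (σ ^ 2 * (Real.exp 2 * Real.exp (-(2 * i)))))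
            = t * r * S * σ * Real.exp 2 / (2 / 3) ^ i * (2 ^ i * Real.exp (-(2 * i))) := by
              field_simp
          _ ≤ t * r * S * σ * Real.exp 2 / (2 / 3) ^ i * ((2 / 3) ^ i * (2 / 3) ^ i) := by
              gcongr
          _ = _ := by field_simp
      refine (add_le_add_left (add_le_add_right hmid _) _).trans (le_of_eq ?_)
      simp only [g]
      ring
    · obtain ⟨a1, a2, a3⟩ := hexp θ
      rw [a1]
      apply hZ
      · exact a2.trans (by gcongr)
      · have hsb := scale_bound r n J i hr hn t V (Dl1 r θ.ofLp) ht hJ h2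
        have h3 : ∑ k, |inner ℝ (e k) θ| ≤ r * 2 * (√2 * t * S * (1 / √2) ^ i) :=
          a3.trans (mul_le_mul_of_nonneg_left hsb (by positivity))
        exact mul_le_mul_of_nonneg_left h3 (by positivity)
  choose Z hZi hZv hZ using hdet
  refine ⟨fun ξ => Z0 ξ + ∑ i ∈ Finset.range n, Z i ξ,
    hZ0i.add (integrable_finsetSum _ fun i _ => hZi i), ?_, fun ξ θ h1 h2 => ?_⟩
  · rw [integral_add hZ0i (integrable_finsetSum _ fun i _ => hZi i),
      integral_finsetSum _ fun i _ => hZi i, add_mul]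
    apply add_le_add
    · refine hZ0v.trans (le_of_eq ?_)
      rw [hSJ]
      simp only [mul_zero, zero_div, neg_zero, Real.exp_zero, mul_one, zero_add]
      field_simp
    · calc ∑ i ∈ Finset.range n, ∫ ξ, Z i ξ ∂gaussVec n σ
          ≤ ∑ i ∈ Finset.range n, g i * (σ * t * S) := Finset.sum_le_sum fun i _ => hZv i
        _ = (∑ i ∈ Finset.range n, g i) * (σ * t * S) := by rw [Finset.sum_mul]
        _ ≤ _ := by
          gcongr
          exact hg.sum_le_tsum _ fun i _ => hg0 i
  · have htop : QP r n (J + n) θ = θ := by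
      apply QP_top r n _ hr
      calc n ≤ 2 ^ n := Nat.lt_two_pow_self.le
        _ ≤ 2 ^ (J + n) := Nat.pow_le_pow_right (by norm_num) (by omega)
    have htel := Finset.sum_range_sub (fun i => QP r n (J + i) θ) n
    simp only [htop, add_zero] at htel
    have hθ : θ = QP r n J θ + ∑ i ∈ Finset.range n, (QP r n (J + (i + 1)) θ - QP r n (J + i) θ) := by
      rw [htel]; abel
    conv_lhs => rw [hθ]
    rw [inner_add_right, inner_sum]
    apply add_le_add
    · obtain ⟨a1, a2⟩ := hexp θ
      rw [a1]
      apply hZ0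
      · exact a2.trans (by gcongr)
      · simp
    · exact Finset.sum_le_sum fun i _ => hZ i ξ θ h1 h2

lemma choose_J (r : ℕ) (hr : 1 ≤ r) (a : ℝ) (ha : 0 ≤ a) :
    ∃ J : ℕ, a ≤ 2 ^ (J * r) ∧ √2 ^ J ≤ 1 + √2 * a ^ ((1 : ℝ) / (2 * (r : ℝ))) := by
  have hex : ∃ J : ℕ, a ≤ 2 ^ (J * r) := by
    obtain ⟨N, hN⟩ := pow_unbounded_of_one_lt a (one_lt_two)
    exact ⟨N, hN.le.trans (pow_le_pow_right₀ (by norm_num) (Nat.le_mul_of_pos_right _ hr))⟩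
  classical
  refine ⟨Nat.find hex, Nat.find_spec hex, ?_⟩
  have hr' : (0 : ℝ) < r := by exact_mod_cast hr
  have hp : 0 ≤ √2 * a ^ ((1 : ℝ) / (2 * (r : ℝ))) := by positivity
  rcases h : Nat.find hex with _ | k
  · simp only [pow_zero]; linarith
  · have hk : ¬ a ≤ 2 ^ (k * r) := Nat.find_min hex (by omega)
    push Not at hk
    have h1 : √(2 : ℝ) ^ k ≤ a ^ ((1 : ℝ) / (2 * (r : ℝ))) := by
      calc √(2 : ℝ) ^ k = ((2 : ℝ) ^ (k * r)) ^ ((1 : ℝ) / (2 * (r : ℝ))) := by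
            rw [Real.sqrt_eq_rpow, ← Real.rpow_natCast, ← Real.rpow_natCast, ← Real.rpow_mul (by norm_num),
              ← Real.rpow_mul (by norm_num)]
            congr 1
            push_cast
            field_simp
        _ ≤ _ := Real.rpow_le_rpow (by positivity) hk.le (by positivity)
    rw [pow_succ]
    nlinarith [Real.sqrt_nonneg 2]

/-- Lemma: bound on the expected Gaussian supremum over
`S_r(V, t) = {θ : ‖θ‖ ≤ t, ‖D^{(r)}θ‖₁ ≤ V n^{1-r}}`. -/
theorem stmt13 (r : ℕ) (hr : 1 ≤ r) :
    ∃ C : ℝ, 0 < C ∧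
      ∀ (n : ℕ), r ≤ n → ∀ σ : ℝ, 0 < σ → ∀ t : ℝ, 0 ≤ t → ∀ V : ℝ, 0 ≤ V →
        (∫ ξ, sSup ((fun θ : Fin n → ℝ => ∑ i, ξ i * θ i) ''
            {θ : Fin n → ℝ | eunorm θ ≤ t ∧ Dl1 r θ ≤ V * (n : ℝ) ^ (1 - (r : ℤ))})
          ∂gaussVec n σ) ≤
          C * σ * t * (Real.sqrt (n : ℝ) * V / t) ^ ((1 : ℝ) / (2 * (r : ℝ))) +
            C * σ * t * Real.sqrt (Real.log (Real.exp 1 * (n : ℝ))) := by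
  obtain ⟨C, hC, hcore⟩ := core r hr
  refine ⟨C * 2, by positivity, fun n hrn σ hσ t ht V hV => ?_⟩
  have hn : 0 < n := by omega
  have hn1 : (1 : ℝ) ≤ n := by exact_mod_cast hn
  have hD0 : Dl1 r (0 : Fin n → ℝ) = 0 := by
    unfold Dl1 DD
    rw [pad_zero]
    simp [dseq_iter_zero]
  have hE : ∀ θ : Fin n → ℝ, eunorm θ = ‖(WithLp.toLp 2 θ : EuclideanSpace ℝ (Fin n))‖ := by
    intro θ
    rw [EuclideanSpace.norm_eq]
    simp [eunorm, sqnorm]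
  have h0mem : (0 : Fin n → ℝ) ∈
      {θ : Fin n → ℝ | eunorm θ ≤ t ∧ Dl1 r θ ≤ V * (n : ℝ) ^ (1 - (r : ℤ))} := by
    refine ⟨?_, ?_⟩
    · simpa [eunorm, sqnorm] using ht
    · rw [hD0]; positivity
  rcases ht.eq_or_lt with rfl | ht
  · have hset : ∀ ξ : Fin n → ℝ, sSup ((fun θ : Fin n → ℝ => ∑ i, ξ i * θ i) ''
        {θ : Fin n → ℝ | eunorm θ ≤ 0 ∧ Dl1 r θ ≤ V * (n : ℝ) ^ (1 - (r : ℤ))}) ≤ 0 := by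
      intro ξ
      apply csSup_le (Set.Nonempty.image _ ⟨_, h0mem⟩)
      rintro _ ⟨θ, ⟨h1, -⟩, rfl⟩
      rw [hE, norm_le_zero_iff] at h1
      have h2 : θ = 0 := by
        have := congrArg WithLp.ofLp h1
        simpa using this
      simp [h2]
    simp only [mul_zero, zero_mul, add_zero]
    exact integral_nonpos hset
  set a := √(n : ℝ) * V / t with ha
  have ha0 : 0 ≤ a := by positivity
  obtain ⟨J, hJ1, hJ2⟩ := choose_J r hr a ha0
  obtain ⟨Z, hZi, hZv, hZ⟩ := hcore n hn σ hσ t ht V J (by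
    rw [ha, div_le_iff₀ ht] at hJ1
    linarith)
  have hlog : 1 ≤ √(Real.log (Real.exp 1 * (n : ℝ))) := by
    rw [Real.one_le_sqrt, Real.log_mul (Real.exp_pos _).ne' (by positivity), Real.log_exp]
    linarith [Real.log_nonneg hn1]
  have hs : √(2 : ℝ) ≤ 2 := by
    rw [Real.sqrt_le_left (by norm_num)]; norm_num
  have hp : 0 ≤ a ^ ((1 : ℝ) / (2 * (r : ℝ))) := by positivity
  calc (∫ ξ, sSup ((fun θ : Fin n → ℝ => ∑ i, ξ i * θ i) ''
            {θ : Fin n → ℝ | eunorm θ ≤ t ∧ Dl1 r θ ≤ V * (n : ℝ) ^ (1 - (r : ℤ))})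
          ∂gaussVec n σ) ≤ ∫ ξ, Z ξ ∂gaussVec n σ := by
        apply integral_mono_of_nonneg _ hZi
        · refine Filter.Eventually.of_forall fun ξ => ?_
          apply csSup_le (Set.Nonempty.image _ ⟨_, h0mem⟩)
          rintro _ ⟨θ, ⟨h1, h2⟩, rfl⟩
          have := hZ ξ (WithLp.toLp 2 θ) (by rw [← hE]; exact h1) h2
          rw [euc_inner] at this
          exact this
        · refine Filter.Eventually.of_forall fun ξ => ?_
          exact Real.sSup_nonneg' ⟨0, ⟨0, h0mem, by simp⟩, le_rfl⟩
    _ ≤ C * (σ * t * √2 ^ J) := hZv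
    _ ≤ C * (σ * t * (2 * √(Real.log (Real.exp 1 * (n : ℝ))) +
          2 * a ^ ((1 : ℝ) / (2 * (r : ℝ))))) := by
        gcongr
        nlinarith
    _ = _ := by ring
end
end
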